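/- Let d_1, d_2, m, h, n ∈ ℕ. Then there exist thresholds t_d', t_r' ∈ ℕ such that for every d ≥ t_d', every r ≥ t_r', and every function ψ* : 𝔽^{d_1} → 𝔽^{d_2}, there exists a composition ψ of finitely many transformer blocks with h heads, head dimension m, feed-forward width r, and hidden dimension d, operating on sequences of length n, with the following property: for every Z ∈ 𝔽^{d×n} whose first d_1 rows form the matrix [x_1,…,x_n] and whose remaining d − d_1 rows are zero, the first d_2 rows of ψ(Z) equal [ψ*(x_1),…,ψ*(x_n)] and the remaining d − d_2 rows of ψ(Z) are zero. -/

import Mathlib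

open scoped Classical

namespace FPT

noncomputable section

/-- Minimal exponent `𝔢_min = -2^(q-1) + 2`. -/
def emin (q : ℕ) : ℤ := -(2 ^ (q - 1) : ℤ) + 2

/-- Maximal exponent `𝔢_max = 2^(q-1) - 1`. -/
def emax (q : ℕ) : ℤ := (2 ^ (q - 1) : ℤ) - 1

/-- The set of finite floating-point numbers with `p` mantissa bits and exponent bits `q`:
normal numbers `±(1.m₁⋯m_p)·2^e = m·2^(e-p)` with `2^p ≤ |m| ≤ 2^(p+1)-1` and
`emin ≤ e ≤ emax`, together with subnormal numbers `±(0.m₁⋯m_p)·2^emin = m·2^(emin-p)`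
with `|m| ≤ 2^p - 1`. -/
def Fset (p q : ℕ) : Set ℝ :=
  {x | ∃ m e : ℤ, |m| ≤ 2 ^ (p + 1) - 1 ∧ emin q ≤ e ∧ e ≤ emax q ∧
      ((2 : ℤ) ^ p ≤ |m| ∨ e = emin q) ∧ x = (m : ℝ) * (2 : ℝ) ^ (e - (p : ℤ))}

/-- The largest positive float `Ω = (2 - 2^(-p))·2^emax`. -/
def Omega (p q : ℕ) : ℝ := (2 - (2 : ℝ) ^ (-(p : ℤ))) * (2 : ℝ) ^ (emax q)

/-- Overflow threshold `Ω + 2^(emax - p - 1)`. -/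
def thr (p q : ℕ) : ℝ := Omega p q + (2 : ℝ) ^ (emax q - (p : ℤ) - 1)

/-- `y` is a float whose last mantissa bit `m_p` is zero, i.e. `y = m·2^(e-p)` with `m` even. -/
def EvenMantissa (p q : ℕ) (y : ℝ) : Prop :=
  ∃ m e : ℤ, |m| ≤ 2 ^ (p + 1) - 1 ∧ emin q ≤ e ∧ e ≤ emax q ∧
    ((2 : ℤ) ^ p ≤ |m| ∨ e = emin q) ∧ y = (m : ℝ) * (2 : ℝ) ^ (e - (p : ℤ)) ∧ 2 ∣ m

/-- `RoundsTo p q x y` : `y` is the rounding of `x` to the nearest float, ties to even. -/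
def RoundsTo (p q : ℕ) (x y : ℝ) : Prop :=
  y ∈ Fset p q ∧ (∀ z ∈ Fset p q, |x - y| ≤ |x - z|) ∧
    ((∀ z ∈ Fset p q, |x - z| = |x - y| → z = y) ∨ EvenMantissa p q y)

/-- Extended floats `𝔽̄ = 𝔽 ∪ {-∞, +∞, NaN}` (the payload of `fin` is meant to lie in `Fset`). -/
inductive EF where
  | fin : ℝ → EF
  | pinf : EF
  | ninf : EF
  | nan : EF

/-- Rounding `⌊·⌉ : ℝ → 𝔽̄`. -/
def rnd (p q : ℕ) (x : ℝ) : EF :=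
  if thr p q ≤ x then .pinf
  else if x ≤ -thr p q then .ninf
  else .fin (Classical.epsilon (RoundsTo p q x))

/-- Floating-point addition `⊕`. -/
def fadd (p q : ℕ) : EF → EF → EF
  | .nan, _ => .nan
  | _, .nan => .nan
  | .fin x, .fin y => rnd p q (x + y)
  | .fin _, .pinf => .pinf
  | .fin _, .ninf => .ninf
  | .pinf, .fin _ => .pinf
  | .ninf, .fin _ => .ninf
  | .pinf, .pinf => .pinf
  | .ninf, .ninf => .ninf
  | .pinf, .ninf => .nan
  | .ninf, .pinf => .nan

/-- Floating-point multiplication `⊗`. -/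
def fmul (p q : ℕ) : EF → EF → EF
  | .nan, _ => .nan
  | _, .nan => .nan
  | .fin x, .fin y => rnd p q (x * y)
  | .fin x, .pinf => if 0 < x then .pinf else if x < 0 then .ninf else .nan
  | .fin x, .ninf => if 0 < x then .ninf else if x < 0 then .pinf else .nan
  | .pinf, .fin y => if 0 < y then .pinf else if y < 0 then .ninf else .nan
  | .ninf, .fin y => if 0 < y then .ninf else if y < 0 then .pinf else .nan
  | .pinf, .pinf => .pinf
  | .ninf, .ninf => .pinf
  | .pinf, .ninf => .ninf
  | .ninf, .pinf => .ninf

/-- Floating-point subtraction `x ⊖ y = x ⊕ ((-1) ⊗ y)`. -/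
def fsub (p q : ℕ) (x y : EF) : EF := fadd p q x (fmul p q (.fin (-1)) y)

/-- Floating-point division (defined for `0 ≤ x ≤ y < ∞`, `y > 0`; NaN propagates). -/
def fdiv (p q : ℕ) : EF → EF → EF
  | _, .nan => .nan
  | .nan, _ => .nan
  | .fin x, .fin y => if 0 < y then rnd p q (x / y) else .nan
  | _, _ => .nan

/-- Correctly rounded exponential `⌊exp⌉`. -/
def fexp (p q : ℕ) : EF → EF
  | .fin x => rnd p q (Real.exp x)
  | .pinf => .pinf
  | .ninf => .fin 0
  | .nan => .nan

/-- Correctly rounded ReLU `ρ = ⌊ReLU⌉`. -/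
def frelu (p q : ℕ) : EF → EF
  | .fin x => rnd p q (max x 0)
  | .pinf => .pinf
  | .ninf => .fin 0
  | .nan => .nan

/-- Left-associative floating-point sum of a list (empty sum is `0`). -/
def fsuml (p q : ℕ) : List EF → EF
  | [] => .fin 0
  | x :: xs => xs.foldl (fadd p q) x

/-- Left-associative floating-point sum `⊕_{i=1}^{n} v i` over `Fin n`. -/
def fsum (p q : ℕ) {n : ℕ} (v : Fin n → EF) : EF := fsuml p q ((List.finRange n).map v)

/-- Matrices of extended floats. -/
abbrev Mat (a b : ℕ) := Fin a → Fin b → EF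

/-- Entrywise floating-point matrix addition. -/
def madd (p q : ℕ) {a b : ℕ} (M N : Mat a b) : Mat a b := fun i j => fadd p q (M i j) (N i j)

/-- Floating-point matrix multiplication with left-associative inner sums. -/
def mmul (p q : ℕ) {a b c : ℕ} (M : Mat a b) (N : Mat b c) : Mat a c :=
  fun i k => fsum p q (fun j => fmul p q (M i j) (N j k))

/-- Maximum of two extended floats (NaN-propagating). -/
def emax2 : EF → EF → EF
  | .nan, _ => .nan
  | _, .nan => .nan
  | .pinf, _ => .pinf
  | _, .pinf => .pinf
  | .fin x, .fin y => .fin (max x y)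
  | .fin x, .ninf => .fin x
  | .ninf, y => y

/-- Maximum entry of a vector of extended floats. -/
def vmax {n : ℕ} (v : Fin n → EF) : EF := ((List.finRange n).map v).foldl emax2 .ninf

/-- Floating-point softmax `σ(x)_i = ⌊exp⌉(x_i ⊖ x_*) ⊘ (⊕_j ⌊exp⌉(x_j ⊖ x_*))`. -/
def fsoftmax (p q : ℕ) {n : ℕ} (v : Fin n → EF) : Fin n → EF := fun i =>
  fdiv p q (fexp p q (fsub p q (v i) (vmax v)))
    (fsum p q (fun j => fexp p q (fsub p q (v j) (vmax v))))

/-- Column-wise application of the floating-point softmax. -/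
def colSoftmax (p q : ℕ) {k n : ℕ} (A : Mat k n) : Mat k n :=
  fun i j => fsoftmax p q (fun i' => A i' j) i

/-- The extended float is a finite float in `𝔽`. -/
def EF.IsF (p q : ℕ) : EF → Prop
  | .fin x => x ∈ Fset p q
  | _ => False

/-- The extended float is a well-formed element of `𝔽̄`. -/
def EF.Valid (p q : ℕ) : EF → Prop
  | .fin x => x ∈ Fset p q
  | _ => True

/-- The extended float is finite (not `±∞` or NaN). -/
def EF.Finite : EF → Prop
  | .fin _ => True
  | _ => False

/-- All entries of a vector are finite floats. -/
def VecFin (p q : ℕ) {a : ℕ} (v : Fin a → EF) : Prop := ∀ i, (v i).IsF p q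

/-- All entries of a matrix are finite floats. -/
def MatFin (p q : ℕ) {a b : ℕ} (M : Mat a b) : Prop := ∀ i j, (M i j).IsF p q

/-- Embed a real matrix as a matrix of extended floats. -/
def toEF {a b : ℕ} (M : Fin a → Fin b → ℝ) : Mat a b := fun i j => .fin (M i j)

/-- Parameters of one transformer block (attention layer followed by feed-forward layer)
with `h` heads, head dimension `m`, feed-forward width `r`, hidden dimension `d`. -/
structure Block (h m r d : ℕ) where
  WK : Fin h → Fin m → Fin d → ℝ
  WQ : Fin h → Fin m → Fin d → ℝ
  WV : Fin h → Fin m → Fin d → ℝ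
  WO : Fin h → Fin d → Fin m → ℝ
  W1 : Fin r → Fin d → ℝ
  W2 : Fin d → Fin r → ℝ
  b1 : Fin r → ℝ
  b2 : Fin d → ℝ

/-- All parameters of the block are floats. -/
def Block.Valid (p q : ℕ) {h m r d : ℕ} (B : Block h m r d) : Prop :=
  (∀ i a b, B.WK i a b ∈ Fset p q) ∧ (∀ i a b, B.WQ i a b ∈ Fset p q) ∧
    (∀ i a b, B.WV i a b ∈ Fset p q) ∧ (∀ i a b, B.WO i a b ∈ Fset p q) ∧
    (∀ a b, B.W1 a b ∈ Fset p q) ∧ (∀ a b, B.W2 a b ∈ Fset p q) ∧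
    (∀ a, B.b1 a ∈ Fset p q) ∧ (∀ a, B.b2 a ∈ Fset p q)

/-- The attention layer
`AT(X) = X ⊕ (⊕_i W_i^O ⊗ ((W_i^V ⊗ X) ⊗ σ((W_i^K ⊗ X)ᵀ ⊗ (W_i^Q ⊗ X))))`. -/
def attnApply (p q : ℕ) {h m r d : ℕ} (B : Block h m r d) {n : ℕ} (X : Mat d n) : Mat d n :=
  madd p q X (fun a b =>
    fsum p q (fun i =>
      (mmul p q (toEF (B.WO i))
        (mmul p q (mmul p q (toEF (B.WV i)) X)
          (colSoftmax p q
            (mmul p q (fun u v => mmul p q (toEF (B.WK i)) X v u)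
              (mmul p q (toEF (B.WQ i)) X))))) a b))

/-- The feed-forward layer `FF(X) = X ⊕ (W₂ ⊗ ρ(W₁ ⊗ X ⊕ b₁1ᵀ) ⊕ b₂1ᵀ)`. -/
def ffApply (p q : ℕ) {h m r d : ℕ} (B : Block h m r d) {n : ℕ} (X : Mat d n) : Mat d n :=
  madd p q X
    (madd p q
      (mmul p q (toEF B.W2)
        (fun i j => frelu p q
          ((madd p q (mmul p q (toEF B.W1) X) (fun a _ => .fin (B.b1 a))) i j)))
      (fun a _ => .fin (B.b2 a)))

/-- One transformer block: `FF ∘ AT`. -/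
def Block.apply (p q : ℕ) {h m r d n : ℕ} (B : Block h m r d) (X : Mat d n) : Mat d n :=
  ffApply p q B (attnApply p q B X)

/-- Composition of a list of transformer blocks (applied from left to right). -/
def blocksApply (p q : ℕ) {h m r d n : ℕ} (L : List (Block h m r d)) (X : Mat d n) : Mat d n :=
  L.foldl (fun Y B => Block.apply p q B Y) X

/-- `f` is a floating-point transformer:
`f(X) = W_out ⊗ g(W_in ⊗ X ⊕ b_in 1ᵀ) ⊕ b_out 1ᵀ` with `g` a nonempty composition of
transformer blocks and all parameters finite floats. -/
def IsTransformer (p q din dout n : ℕ) (f : Mat din n → Mat dout n) : Prop :=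
  ∃ (h m r d : ℕ) (L : List (Block h m r d)) (Win : Fin d → Fin din → ℝ) (bin : Fin d → ℝ)
      (Wout : Fin dout → Fin d → ℝ) (bout : Fin dout → ℝ),
    0 < h ∧ 0 < m ∧ 0 < r ∧ 0 < d ∧ L ≠ [] ∧ (∀ B ∈ L, B.Valid p q) ∧
      (∀ i j, Win i j ∈ Fset p q) ∧ (∀ i, bin i ∈ Fset p q) ∧
      (∀ i j, Wout i j ∈ Fset p q) ∧ (∀ i, bout i ∈ Fset p q) ∧
      ∀ X : Mat din n,
        f X = madd p q
          (mmul p q (toEF Wout)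
            (blocksApply p q L
              (madd p q (mmul p q (toEF Win) X) (fun i _ => .fin (bin i)))))
          (fun i _ => .fin (bout i))

/-- Column permutation: column `j` of `permCols π X` is column `π j` of `X`. -/
def permCols {a n : ℕ} (π : Equiv.Perm (Fin n)) (X : Mat a n) : Mat a n := fun i j => X i (π j)

/-- The transposition `π_{(1,2)}^n` of the first two coordinates. -/
def swap12 (n : ℕ) (hn : 2 ≤ n) : Equiv.Perm (Fin n) :=
  Equiv.swap ⟨0, by omega⟩ ⟨1, by omega⟩

/-- The columns of `X` are pairwise distinct. -/
def DistinctCols {a n : ℕ} (X : Mat a n) : Prop :=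
  ∀ j k : Fin n, j ≠ k → ∃ i, X i j ≠ X i k

/-- `(α,β)`-similarity (with 1-based column index `i = j+1`). -/
def Similar {a n : ℕ} (α β : ℕ) (X Y : Mat a n) : Prop :=
  ∃ z1 z2 : Fin a → EF,
    (∀ j : Fin n, (j : ℕ) + 1 ≤ α → ∀ i, X i j = z1 i) ∧
    (∀ j : Fin n, α < (j : ℕ) + 1 → (j : ℕ) + 1 ≤ β → ∀ i, X i j = z2 i) ∧
    (∀ j : Fin n, (j : ℕ) + 1 < α → ∀ i, Y i j = z1 i) ∧
    (∀ j : Fin n, α ≤ (j : ℕ) + 1 → (j : ℕ) + 1 ≤ β → ∀ i, Y i j = z2 i) ∧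
    (∀ j : Fin n, β < (j : ℕ) + 1 → ∀ i, X i j = Y i j)

/-- The smallest float strictly greater than `x` (junk value if none exists). -/
def succF (p q : ℕ) (x : ℝ) : ℝ := sInf {y | y ∈ Fset p q ∧ x < y}

/-- Successor on extended floats: the smallest element of `𝔽 ∪ {+∞}` strictly above. -/
def succEF (p q : ℕ) : EF → EF
  | .fin r => if ∃ y ∈ Fset p q, r < y then .fin (succF p q r) else .pinf
  | e => e

/-- Floating-point affine transformation `φ(x) = W ⊗ x ⊕ b`. -/
def affApply (p q : ℕ) {a b : ℕ} (W : Fin b → Fin a → ℝ) (c : ℝ) (v : Fin a → EF) :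
    Fin b → EF :=
  fun i => fadd p q (fsum p q (fun j => fmul p q (.fin (W i j)) (v j))) (.fin c)

/-- All intermediate values of `φ(x) = W ⊗ x ⊕ b` on input `v`, including every
left-associative partial sum of the matrix–vector product, are finite. -/
def AffIntermFin (p q : ℕ) {a b : ℕ} (W : Fin b → Fin a → ℝ) (c : ℝ) (v : Fin a → EF) : Prop :=
  ∀ i : Fin b,
    (∀ k : ℕ,
      (fsuml p q (((List.finRange a).take k).map
        (fun j => fmul p q (.fin (W i j)) (v j)))).Finite) ∧
    (affApply p q W c v i).Finite

end
end FPT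

namespace FPT

section Rounding

variable {p q : ℕ}

lemma Fset_finite (p q : ℕ) : (Fset p q).Finite := by
  refine Set.Finite.subset (((Set.finite_Icc (-(2 ^ (p + 1) : ℤ)) (2 ^ (p + 1))).prod
    (Set.finite_Icc (emin q) (emax q))).image
      (fun me : ℤ × ℤ => (me.1 : ℝ) * (2 : ℝ) ^ (me.2 - (p : ℤ)))) ?_
  rintro x ⟨m, e, hm, h1, h2, -, rfl⟩
  have := abs_le.1 hm
  exact ⟨(m, e), ⟨⟨by dsimp only; linarith, by dsimp only; linarith⟩, h1, h2⟩, rfl⟩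

lemma neg_mem_Fset {x : ℝ} (hx : x ∈ Fset p q) : -x ∈ Fset p q := by
  obtain ⟨m, e, hm, h1, h2, h3, rfl⟩ := hx
  exact ⟨-m, e, by rwa [abs_neg], h1, h2, by rwa [abs_neg], by push_cast; ring⟩

lemma EvenMantissa.neg {x : ℝ} (hx : EvenMantissa p q x) : EvenMantissa p q (-x) := by
  obtain ⟨m, e, hm, h1, h2, h3, rfl, h4⟩ := hx
  exact ⟨-m, e, by rwa [abs_neg], h1, h2, by rwa [abs_neg], by push_cast; ring,
    (dvd_neg).2 h4⟩

lemma zpow_mem_Fset {e : ℤ} (h1 : emin q ≤ e) (h2 : e ≤ emax q) : (2 : ℝ) ^ e ∈ Fset p q := by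
  refine ⟨2 ^ p, e, ?_, h1, h2, Or.inl (le_abs_self _), ?_⟩
  · rw [abs_of_nonneg (by positivity), pow_succ]
    have : (1 : ℤ) ≤ 2 ^ p := one_le_pow₀ (by norm_num)
    linarith
  · push_cast
    rw [← zpow_natCast, ← zpow_add₀ (by norm_num)]
    congr 1; ring

lemma five_le (hp : 2 ≤ p) (hpq : (p : ℤ) ≤ 2 ^ (q - 1) - 3) : (5 : ℤ) ≤ 2 ^ (q - 1) := by
  have : (2 : ℤ) ≤ p := by exact_mod_cast hp
  linarith

lemma emin_le_emax (hp : 2 ≤ p) (hpq : (p : ℤ) ≤ 2 ^ (q - 1) - 3) : emin q ≤ emax q := by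
  have := five_le hp hpq
  unfold emin emax; linarith

lemma zero_mem_Fset (hp : 2 ≤ p) (hpq : (p : ℤ) ≤ 2 ^ (q - 1) - 3) : (0 : ℝ) ∈ Fset p q :=
  ⟨0, emin q, by simpa using one_le_pow₀ (M₀ := ℤ) (a := 2) (by norm_num), le_rfl,
    emin_le_emax hp hpq, Or.inr rfl, by simp⟩

lemma one_mem_Fset (hp : 2 ≤ p) (hpq : (p : ℤ) ≤ 2 ^ (q - 1) - 3) : (1 : ℝ) ∈ Fset p q := by
  have := five_le hp hpq
  simpa using zpow_mem_Fset (p := p) (q := q) (e := 0) (by unfold emin; linarith)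
    (by unfold emax; linarith)

/-- The smallest positive float. -/
lemma tiny_mem_Fset (hp : 2 ≤ p) (hpq : (p : ℤ) ≤ 2 ^ (q - 1) - 3) :
    (2 : ℝ) ^ (emin q - (p : ℤ)) ∈ Fset p q := by
  refine ⟨1, emin q, ?_, le_rfl, emin_le_emax hp hpq, Or.inr rfl, by simp⟩
  have : (2 : ℤ) ≤ 2 ^ (p + 1) := by
    rw [pow_succ]
    have : (1 : ℤ) ≤ 2 ^ p := one_le_pow₀ (by norm_num)
    linarith
  simpa using by linarith

lemma Omega_eq (p q : ℕ) :
    Omega p q = ((2 : ℝ) ^ (p + 1) - 1) * (2 : ℝ) ^ (emax q - (p : ℤ)) := by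
  unfold Omega
  rw [sub_eq_add_neg (emax q), zpow_add₀ (by norm_num), zpow_neg, zpow_natCast, pow_succ]
  field_simp

lemma abs_le_Omega {x : ℝ} (hx : x ∈ Fset p q) : |x| ≤ Omega p q := by
  obtain ⟨m, e, hm, h1, h2, h3, rfl⟩ := hx
  rw [Omega_eq, abs_mul, abs_of_pos (a := (2 : ℝ) ^ (e - (p : ℤ))) (by positivity)]
  have hm' : |(m : ℝ)| ≤ 2 ^ (p + 1) - 1 := by exact_mod_cast hm
  have : (2 : ℝ) ^ (e - (p : ℤ)) ≤ (2 : ℝ) ^ (emax q - (p : ℤ)) :=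
    zpow_le_zpow_right₀ (by norm_num) (by linarith)
  exact mul_le_mul hm' this (by positivity) ((abs_nonneg _).trans hm')

lemma Omega_add_one_lt_thr (hpq : (p : ℤ) ≤ 2 ^ (q - 1) - 3) : Omega p q + 1 < thr p q := by
  unfold thr
  have : (1 : ℝ) < (2 : ℝ) ^ (emax q - (p : ℤ) - 1) :=
    one_lt_zpow₀ (by norm_num) (by unfold emax; linarith)
  linarith

/-- Every float is an integer multiple of the smallest positive float. -/
lemma exists_int_mul_tiny {x : ℝ} (hx : x ∈ Fset p q) :
    ∃ k : ℤ, x = k * (2 : ℝ) ^ (emin q - (p : ℤ)) := by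
  obtain ⟨m, e, hm, h1, h2, h3, rfl⟩ := hx
  obtain ⟨k, hk⟩ := Int.eq_ofNat_of_zero_le (sub_nonneg.2 h1)
  refine ⟨m * 2 ^ k, ?_⟩
  push_cast
  rw [mul_assoc, ← zpow_natCast, ← zpow_add₀ (by norm_num)]
  congr 2; omega

lemma tiny_le_sub {x y : ℝ} (hx : x ∈ Fset p q) (hy : y ∈ Fset p q) (h : y < x) :
    (2 : ℝ) ^ (emin q - (p : ℤ)) ≤ x - y := by
  obtain ⟨k, rfl⟩ := exists_int_mul_tiny hx
  obtain ⟨l, rfl⟩ := exists_int_mul_tiny hy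
  have h0 : (0 : ℝ) < (2 : ℝ) ^ (emin q - (p : ℤ)) := by positivity
  have h1 : l < k := by exact_mod_cast lt_of_mul_lt_mul_right h h0.le
  have h2 : (l : ℝ) + 1 ≤ k := by exact_mod_cast h1
  nlinarith

/-- Of two consecutive nonnegative floats at least one has an even mantissa. -/
lemma even_of_consecutive_nonneg (hp : 2 ≤ p) {y z : ℝ} (hy : y ∈ Fset p q) (hz : z ∈ Fset p q)
    (h0 : 0 ≤ y) (hyz : y < z) (hcons : ∀ w ∈ Fset p q, y < w → z ≤ w) :
    EvenMantissa p q y ∨ EvenMantissa p q z := by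
  obtain ⟨m, e, hm, h1, h2, h3, hye⟩ := id hy
  by_cases hev : 2 ∣ m
  · exact Or.inl ⟨m, e, hm, h1, h2, h3, hye, hev⟩
  right
  have hpos : (0 : ℝ) < (2 : ℝ) ^ (e - (p : ℤ)) := by positivity
  have hm0 : 0 ≤ m := by
    have : (0 : ℝ) ≤ m := by
      rw [hye] at h0
      exact nonneg_of_mul_nonneg_left h0 hpos
    exact_mod_cast this
  rw [abs_of_nonneg hm0] at hm h3
  have h2p : (0 : ℤ) < 2 ^ p := by positivity
  have hps : (2 : ℤ) ^ (p + 1) = 2 * 2 ^ p := by rw [pow_succ]; ring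
  -- the float `z` lies at least one unit in the last place above `y`
  have hlow : y + (2 : ℝ) ^ (e - (p : ℤ)) ≤ z := by
    obtain ⟨m', e', hm', h1', h2', h3', hze⟩ := id hz
    have hpos' : (0 : ℝ) < (2 : ℝ) ^ (e' - (p : ℤ)) := by positivity
    rcases le_or_gt e e' with hee | hee
    · obtain ⟨k, hk⟩ := Int.eq_ofNat_of_zero_le (sub_nonneg.2 hee)
      have hz2 : z = ((m' * 2 ^ k : ℤ) : ℝ) * (2 : ℝ) ^ (e - (p : ℤ)) := by
        rw [hze]; push_cast
        rw [mul_assoc, ← zpow_natCast, ← zpow_add₀ (by norm_num)]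
        congr 2; omega
      rw [hz2, hye] at hyz
      have h5 : m < m' * 2 ^ k := by exact_mod_cast lt_of_mul_lt_mul_right hyz hpos.le
      have h6 : (m : ℝ) + 1 ≤ ((m' * 2 ^ k : ℤ) : ℝ) := by exact_mod_cast h5
      rw [hz2, hye]
      nlinarith
    · exfalso
      have hmp : (2 : ℤ) ^ p ≤ m := h3.resolve_right (by omega)
      have hmp' : (2 : ℝ) ^ p ≤ m := by exact_mod_cast hmp
      have hm'' : (m' : ℝ) ≤ 2 * 2 ^ p := by
        have : m' ≤ 2 * 2 ^ p := by
          have := le_abs_self m'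
          linarith
        exact_mod_cast this
      have hstep : 2 * (2 : ℝ) ^ (e' - (p : ℤ)) ≤ (2 : ℝ) ^ (e - (p : ℤ)) := by
        rw [← zpow_one_add₀ (by norm_num)]
        exact zpow_le_zpow_right₀ (by norm_num) (by linarith)
      have : z ≤ y := by
        rw [hze, hye]
        calc (m' : ℝ) * (2 : ℝ) ^ (e' - (p : ℤ))
            ≤ (2 * 2 ^ p) * (2 : ℝ) ^ (e' - (p : ℤ)) := by gcongr
          _ = 2 ^ p * (2 * (2 : ℝ) ^ (e' - (p : ℤ))) := by ring
          _ ≤ m * (2 : ℝ) ^ (e - (p : ℤ)) := by gcongr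
      linarith
  have hsucc : EvenMantissa p q (y + (2 : ℝ) ^ (e - (p : ℤ))) := by
    rcases eq_or_lt_of_le hm with hmax | hlt
    · have hlt : e < emax q := by
        refine lt_of_le_of_ne h2 fun he => ?_
        have hy' : y = Omega p q := by
          rw [Omega_eq, hye, hmax, he]; push_cast; ring
        have := (le_abs_self z).trans (abs_le_Omega hz)
        linarith
      refine ⟨2 ^ p, e + 1, ?_, by omega, by omega, Or.inl (le_abs_self _), ?_, ?_⟩
      · rw [abs_of_pos h2p]; omega
      · rw [hye, hmax, add_sub_right_comm, zpow_add_one₀ (by norm_num)]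
        push_cast
        rw [pow_succ]; ring
      · exact dvd_pow_self 2 (by omega)
    · refine ⟨m + 1, e, ?_, h1, h2, ?_, ?_, by omega⟩
      · rw [abs_of_nonneg (by omega)]; omega
      · rw [abs_of_nonneg (by omega)]; omega
      · rw [hye]; push_cast; ring
  have hmem : y + (2 : ℝ) ^ (e - (p : ℤ)) ∈ Fset p q := by
    obtain ⟨m', e', a, b, c, d, f, -⟩ := hsucc
    exact ⟨m', e', a, b, c, d, f⟩
  have : z = y + (2 : ℝ) ^ (e - (p : ℤ)) :=
    le_antisymm (hcons _ hmem (by linarith)) hlow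
  rw [this]
  exact hsucc

lemma even_of_consecutive (hp : 2 ≤ p) (hpq : (p : ℤ) ≤ 2 ^ (q - 1) - 3) {y z : ℝ}
    (hy : y ∈ Fset p q) (hz : z ∈ Fset p q) (hyz : y < z)
    (hcons : ∀ w ∈ Fset p q, y < w → z ≤ w) :
    EvenMantissa p q y ∨ EvenMantissa p q z := by
  rcases le_or_gt 0 y with h0 | h0
  · exact even_of_consecutive_nonneg hp hy hz h0 hyz hcons
  · have hz0 : z ≤ 0 := hcons 0 (zero_mem_Fset hp hpq) h0
    have := even_of_consecutive_nonneg hp (neg_mem_Fset hz) (neg_mem_Fset hy) (by linarith)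
      (by linarith) (fun w hw hlt => by
        by_contra hcon
        have := hcons (-w) (neg_mem_Fset hw) (by linarith)
        linarith)
    rcases this with h | h
    · exact Or.inr (by simpa using h.neg)
    · exact Or.inl (by simpa using h.neg)

lemma exists_roundsTo (hp : 2 ≤ p) (hpq : (p : ℤ) ≤ 2 ^ (q - 1) - 3) (x : ℝ) :
    ∃ y, RoundsTo p q x y := by
  obtain ⟨y, hy, hmin⟩ := Set.exists_min_image (Fset p q) (fun z => |x - z|) (Fset_finite p q)
    ⟨0, zero_mem_Fset hp hpq⟩
  by_cases huniq : ∀ z ∈ Fset p q, |x - z| = |x - y| → z = y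
  · exact ⟨y, hy, hmin, Or.inl huniq⟩
  push Not at huniq
  obtain ⟨z, hz, hzy, hne⟩ := huniq
  have key : ∀ a ∈ Fset p q, ∀ b ∈ Fset p q, a < b → |x - a| = |x - b| →
      (∀ w ∈ Fset p q, |x - a| ≤ |x - w|) → ∃ y, RoundsTo p q x y := by
    intro a ha b hb hab heq hmin
    have hmid : x - a = b - x := by
      rcases abs_eq_abs.1 heq with h | h <;> linarith
    rw [abs_of_pos (by linarith : 0 < x - a)] at hmin heq
    have hcons : ∀ w ∈ Fset p q, a < w → b ≤ w := by
      intro w hw haw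
      rcases le_abs.1 (hmin w hw) with h | h <;> linarith
    rcases even_of_consecutive hp hpq ha hb hab hcons with h | h
    · exact ⟨a, ha, by rwa [abs_of_pos (by linarith : 0 < x - a)], Or.inr h⟩
    · exact ⟨b, hb, by rwa [← heq], Or.inr h⟩
  rcases lt_or_gt_of_ne hne with h | h
  · exact key z hz y hy h hzy (by rwa [hzy])
  · exact key y hy z hz h hzy.symm hmin

/-- Rounding within the finite range produces a nearest float. -/
lemma exists_rnd_eq (hp : 2 ≤ p) (hpq : (p : ℤ) ≤ 2 ^ (q - 1) - 3) {x : ℝ}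
    (h1 : x < thr p q) (h2 : -thr p q < x) :
    ∃ y ∈ Fset p q, rnd p q x = .fin y ∧ ∀ z ∈ Fset p q, |x - y| ≤ |x - z| := by
  have := Classical.epsilon_spec (exists_roundsTo hp hpq x)
  exact ⟨_, this.1, by rw [rnd, if_neg (not_le.2 h1), if_neg (not_le.2 h2)], this.2.1⟩

lemma rnd_of_mem (hp : 2 ≤ p) (hpq : (p : ℤ) ≤ 2 ^ (q - 1) - 3) {x : ℝ} (hx : x ∈ Fset p q) :
    rnd p q x = .fin x := by
  have h := abs_le.1 (abs_le_Omega hx)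
  have ht := Omega_add_one_lt_thr hpq
  obtain ⟨y, -, hxy, hmin⟩ := exists_rnd_eq hp hpq (x := x) (by linarith) (by linarith)
  have := hmin x hx
  rw [sub_self, abs_zero] at this
  rw [hxy, ← sub_eq_zero.1 (abs_nonpos_iff.1 this)]

/-- `e` is at most the real number `f`: it is `-∞` or a float that is at most `f`. -/
def AtMost (p q : ℕ) (f : ℝ) (e : EF) : Prop :=
  e = .ninf ∨ ∃ y ∈ Fset p q, y ≤ f ∧ e = .fin y

lemma rnd_atMost (hp : 2 ≤ p) (hpq : (p : ℤ) ≤ 2 ^ (q - 1) - 3) {x f : ℝ} (hf : f ∈ Fset p q)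
    (hxf : x ≤ f) : AtMost p q f (rnd p q x) := by
  have h := abs_le.1 (abs_le_Omega hf)
  have ht := Omega_add_one_lt_thr hpq
  by_cases hx : x ≤ -thr p q
  · left
    rw [rnd, if_neg (by linarith), if_pos hx]
  · obtain ⟨y, hy, hxy, hmin⟩ := exists_rnd_eq hp hpq (x := x) (by linarith) (not_le.1 hx)
    refine Or.inr ⟨y, hy, ?_, hxy⟩
    by_contra hcon
    have := hmin f hf
    rw [abs_of_nonpos (by linarith), abs_of_nonpos (by linarith)] at this
    linarith

/-- Rounding is monotone with respect to finite lower bounds. -/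
lemma exists_rnd_ge (hp : 2 ≤ p) (hpq : (p : ℤ) ≤ 2 ^ (q - 1) - 3) {x f : ℝ} (hf : f ∈ Fset p q)
    (hfx : f ≤ x) (hx : x < thr p q) : ∃ y ∈ Fset p q, rnd p q x = .fin y ∧ f ≤ y := by
  have h := abs_le.1 (abs_le_Omega hf)
  have ht := Omega_add_one_lt_thr hpq
  obtain ⟨y, hy, hxy, hmin⟩ := exists_rnd_eq hp hpq (x := x) hx (by linarith)
  refine ⟨y, hy, hxy, ?_⟩
  by_contra hcon
  have := hmin f hf
  rw [abs_of_nonneg (by linarith), abs_of_nonneg (by linarith)] at this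
  linarith

end Rounding

section Sums

variable {p q : ℕ}

lemma fadd_fin (hp : 2 ≤ p) (hpq : (p : ℤ) ≤ 2 ^ (q - 1) - 3) {x y : ℝ}
    (h : x + y ∈ Fset p q) : fadd p q (.fin x) (.fin y) = .fin (x + y) :=
  rnd_of_mem hp hpq h

lemma fmul_fin (hp : 2 ≤ p) (hpq : (p : ℤ) ≤ 2 ^ (q - 1) - 3) {x y : ℝ}
    (h : x * y ∈ Fset p q) : fmul p q (.fin x) (.fin y) = .fin (x * y) :=
  rnd_of_mem hp hpq h

lemma zero_fadd_of_valid (hp : 2 ≤ p) (hpq : (p : ℤ) ≤ 2 ^ (q - 1) - 3) {e : EF}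
    (he : e.Valid p q) : fadd p q (.fin 0) e = e := by
  cases e with
  | fin x => rw [fadd_fin hp hpq (by rw [zero_add]; exact he), zero_add]
  | _ => rfl

lemma fsuml_eq_foldl (hp : 2 ≤ p) (hpq : (p : ℤ) ≤ 2 ^ (q - 1) - 3) {l : List EF}
    (hl : ∀ e ∈ l, e.Valid p q) : fsuml p q l = l.foldl (fadd p q) (.fin 0) := by
  cases l with
  | nil => rfl
  | cons e l => rw [fsuml, List.foldl_cons, zero_fadd_of_valid hp hpq (hl e (by simp))]

lemma foldl_fadd_zeros (hp : 2 ≤ p) (hpq : (p : ℤ) ≤ 2 ^ (q - 1) - 3) {x : ℝ}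
    (hx : x ∈ Fset p q) {l : List EF} (hl : ∀ e ∈ l, e = .fin 0) :
    l.foldl (fadd p q) (.fin x) = .fin x := by
  induction l with
  | nil => rfl
  | cons e l ih =>
    rw [List.foldl_cons, hl e (by simp), fadd_fin hp hpq (by simpa using hx), add_zero]
    exact ih fun e he => hl e (by simp [he])

lemma fsum_zeros (hp : 2 ≤ p) (hpq : (p : ℤ) ≤ 2 ^ (q - 1) - 3) {n : ℕ} {v : Fin n → EF}
    (hv : ∀ i, v i = .fin 0) : fsum p q v = .fin 0 := by
  have h : ∀ e ∈ (List.finRange n).map v, e = .fin 0 := by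
    intro e he
    obtain ⟨i, -, rfl⟩ := List.mem_map.1 he
    exact hv i
  have h0 := zero_mem_Fset hp hpq
  rw [fsum, fsuml_eq_foldl hp hpq fun e he => by rw [h e he]; exact h0,
    foldl_fadd_zeros hp hpq h0 h]

lemma foldl_fadd_single (hp : 2 ≤ p) (hpq : (p : ℤ) ≤ 2 ^ (q - 1) - 3) {ι : Type*} {v : ι → EF}
    {i₀ : ι} {t : ℝ} (ht : t ∈ Fset p q) (hi₀ : v i₀ = .fin t)
    (hv : ∀ i, i ≠ i₀ → v i = .fin 0) {l : List ι} (hl : l.Nodup) (hmem : i₀ ∈ l) :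
    (l.map v).foldl (fadd p q) (.fin 0) = .fin t := by
  induction l with
  | nil => simp at hmem
  | cons i l ih =>
    rw [List.map_cons, List.foldl_cons]
    have hnd := List.nodup_cons.1 hl
    by_cases hi : i = i₀
    · subst hi
      rw [hi₀, fadd_fin hp hpq (by simpa using ht), zero_add]
      refine foldl_fadd_zeros hp hpq ht fun e he => ?_
      obtain ⟨j, hj, rfl⟩ := List.mem_map.1 he
      exact hv j fun h => hnd.1 (h ▸ hj)
    · rw [hv i hi, fadd_fin hp hpq (by simpa using zero_mem_Fset hp hpq), add_zero]
      exact ih hnd.2 ((List.mem_cons.1 hmem).resolve_left (Ne.symm hi))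

/-- A sum with at most one nonzero term is exact. -/
lemma fsum_single (hp : 2 ≤ p) (hpq : (p : ℤ) ≤ 2 ^ (q - 1) - 3) {n : ℕ} {v : Fin n → EF}
    {i₀ : Fin n} {t : ℝ} (ht : t ∈ Fset p q) (hi₀ : v i₀ = .fin t)
    (hv : ∀ i, i ≠ i₀ → v i = .fin 0) : fsum p q v = .fin t := by
  rw [fsum, fsuml_eq_foldl hp hpq,
    foldl_fadd_single hp hpq ht hi₀ hv (List.nodup_finRange n) (List.mem_finRange i₀)]
  intro e he
  obtain ⟨j, -, rfl⟩ := List.mem_map.1 he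
  by_cases hj : j = i₀
  · rw [hj, hi₀]; exact ht
  · rw [hv j hj]; exact zero_mem_Fset hp hpq

lemma AtMost.fadd (hp : 2 ≤ p) (hpq : (p : ℤ) ≤ 2 ^ (q - 1) - 3) {x y f : ℝ} {a b : EF}
    (hf : f ∈ Fset p q) (hxy : x + y ≤ f) (ha : AtMost p q x a) (hb : AtMost p q y b) :
    AtMost p q f (fadd p q a b) := by
  rcases ha with rfl | ⟨s, -, hs, rfl⟩ <;> rcases hb with rfl | ⟨t, -, ht, rfl⟩
  · exact Or.inl rfl
  · exact Or.inl rfl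
  · exact Or.inl rfl
  · exact rnd_atMost hp hpq hf (by linarith)

lemma AtMost.valid {f : ℝ} {e : EF} (he : AtMost p q f e) : e.Valid p q := by
  rcases he with rfl | ⟨y, hy, -, rfl⟩
  · trivial
  · exact hy

lemma foldl_fadd_atMost (hp : 2 ≤ p) (hpq : (p : ℤ) ≤ 2 ^ (q - 1) - 3) {f : ℝ}
    (hf : f ∈ Fset p q) {l : List EF} (hl : ∀ e ∈ l, AtMost p q 0 e) {a : EF}
    (ha : AtMost p q f a) : AtMost p q f (l.foldl (fadd p q) a) := by
  induction l generalizing a with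
  | nil => exact ha
  | cons e l ih =>
    exact ih (fun e he => hl e (by simp [he]))
      (ha.fadd hp hpq hf (by simp) (hl e (by simp)))

lemma foldl_fadd_atMost_of_mem (hp : 2 ≤ p) (hpq : (p : ℤ) ≤ 2 ^ (q - 1) - 3) {f : ℝ}
    (hf : f ∈ Fset p q) {l : List EF} (hl : ∀ e ∈ l, AtMost p q 0 e) {a : EF}
    (ha : AtMost p q 0 a) (hex : ∃ e ∈ l, AtMost p q f e) :
    AtMost p q f (l.foldl (fadd p q) a) := by
  induction l generalizing a with
  | nil => simp at hex
  | cons e l ih =>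
    have hl' : ∀ e ∈ l, AtMost p q 0 e := fun e he => hl e (by simp [he])
    obtain ⟨e', he', hfe'⟩ := hex
    rcases List.mem_cons.1 he' with rfl | he'
    · exact foldl_fadd_atMost hp hpq hf hl' (ha.fadd hp hpq hf (by simp) hfe')
    · exact ih hl' (ha.fadd hp hpq (zero_mem_Fset hp hpq) (by simp) (hl e (by simp)))
        ⟨e', he', hfe'⟩

/-- A sum of nonpositive terms one of which is at most `f` is at most `f`. -/
lemma fsum_atMost (hp : 2 ≤ p) (hpq : (p : ℤ) ≤ 2 ^ (q - 1) - 3) {n : ℕ} {v : Fin n → EF} {f : ℝ}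
    (hf : f ∈ Fset p q) (hv : ∀ i, AtMost p q 0 (v i)) {i₀ : Fin n} (hi₀ : AtMost p q f (v i₀)) :
    AtMost p q f (fsum p q v) := by
  have h : ∀ e ∈ (List.finRange n).map v, AtMost p q 0 e := by
    intro e he
    obtain ⟨i, -, rfl⟩ := List.mem_map.1 he
    exact hv i
  rw [fsum, fsuml_eq_foldl hp hpq fun e he => (h e he).valid]
  exact foldl_fadd_atMost_of_mem hp hpq hf h (Or.inr ⟨0, zero_mem_Fset hp hpq, le_rfl, rfl⟩)
    ⟨_, List.mem_map.2 ⟨i₀, List.mem_finRange i₀, rfl⟩, hi₀⟩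

lemma frelu_atMost_zero (hp : 2 ≤ p) (hpq : (p : ℤ) ≤ 2 ^ (q - 1) - 3) {e : EF}
    (he : AtMost p q 0 e) : frelu p q e = .fin 0 := by
  rcases he with rfl | ⟨y, -, hy, rfl⟩
  · rfl
  · rw [frelu, max_eq_right hy, rnd_of_mem hp hpq (zero_mem_Fset hp hpq)]

lemma frelu_fin (hp : 2 ≤ p) (hpq : (p : ℤ) ≤ 2 ^ (q - 1) - 3) {x : ℝ} (hx : x ∈ Fset p q) :
    frelu p q (.fin x) = .fin (max x 0) :=
  rnd_of_mem hp hpq (by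
    rcases max_choice x 0 with h | h <;> rw [h]
    exacts [hx, zero_mem_Fset hp hpq])

end Sums

section Attention

variable {p q : ℕ}

lemma foldl_fadd_ones (hp : 2 ≤ p) (hpq : (p : ℤ) ≤ 2 ^ (q - 1) - 3) {l : List EF}
    (hl : ∀ e ∈ l, e = .fin 1) {s : ℝ} (hs : s ∈ Fset p q) (hs1 : 1 ≤ s) :
    ∃ t ∈ Fset p q, 1 ≤ t ∧ l.foldl (fadd p q) (.fin s) = .fin t := by
  induction l generalizing s with
  | nil => exact ⟨s, hs, hs1, rfl⟩
  | cons e l ih =>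
    have := (le_abs_self s).trans (abs_le_Omega hs)
    obtain ⟨t, ht, hst, ht1⟩ := exists_rnd_ge hp hpq (x := s + 1) (one_mem_Fset hp hpq)
      (by linarith) (by linarith [Omega_add_one_lt_thr hpq])
    rw [List.foldl_cons, hl e (by simp), fadd, hst]
    exact ih (fun e he => hl e (by simp [he])) ht ht1

lemma foldl_emax2_zeros {l : List EF} (hl : ∀ e ∈ l, e = .fin 0) :
    l.foldl emax2 (.fin 0) = .fin 0 := by
  induction l with
  | nil => rfl
  | cons e l ih =>
    rw [List.foldl_cons, hl e (by simp), emax2, max_self]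
    exact ih fun e he => hl e (by simp [he])

lemma vmax_zeros {n : ℕ} {v : Fin n → EF} (hn : 0 < n) (hv : ∀ i, v i = .fin 0) :
    vmax v = .fin 0 := by
  obtain ⟨n, rfl⟩ : ∃ k, n = k + 1 := ⟨n - 1, by omega⟩
  rw [vmax, List.finRange_succ, List.map_cons, List.foldl_cons, hv 0,
    show emax2 .ninf (.fin 0) = .fin 0 from rfl]
  refine foldl_emax2_zeros fun e he => ?_
  obtain ⟨i, -, rfl⟩ := List.mem_map.1 he
  exact hv i

/-- The softmax of the zero vector is finite. -/
lemma fsoftmax_zeros (hp : 2 ≤ p) (hpq : (p : ℤ) ≤ 2 ^ (q - 1) - 3) {n : ℕ} (hn : 0 < n)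
    {v : Fin n → EF} (hv : ∀ i, v i = .fin 0) (i : Fin n) :
    ∃ t, fsoftmax p q v i = .fin t := by
  have h0 := zero_mem_Fset hp hpq
  have h1 := one_mem_Fset hp hpq
  have hexp : ∀ i, fexp p q (fsub p q (v i) (vmax v)) = .fin 1 := by
    intro i
    rw [vmax_zeros hn hv, hv i, fsub, fmul_fin hp hpq (by simpa using h0),
      fadd_fin hp hpq (by simpa using h0), fexp]
    simpa using rnd_of_mem hp hpq h1
  have hsum : ∃ t ∈ Fset p q, 1 ≤ t ∧
      fsum p q (fun j => fexp p q (fsub p q (v j) (vmax v))) = .fin t := by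
    simp_rw [hexp]
    obtain ⟨n, rfl⟩ : ∃ k, n = k + 1 := ⟨n - 1, by omega⟩
    rw [fsum, List.finRange_succ, List.map_cons, fsuml]
    refine foldl_fadd_ones hp hpq (fun e he => ?_) h1 le_rfl
    obtain ⟨i, -, rfl⟩ := List.mem_map.1 he
    rfl
  obtain ⟨t, -, ht1, hsum⟩ := hsum
  have hO := (le_abs_self _).trans (abs_le_Omega h1)
  have hle : 1 / t ≤ 1 := by rw [div_le_one (by linarith)]; exact ht1
  have hnn : 0 ≤ 1 / t := by positivity
  obtain ⟨y, -, hy, -⟩ := exists_rnd_ge hp hpq (x := 1 / t) h0 hnn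
    (by linarith [Omega_add_one_lt_thr hpq])
  refine ⟨y, ?_⟩
  rw [fsoftmax, hsum, hexp, fdiv, if_pos (by linarith), hy]

lemma zero_mmul (hp : 2 ≤ p) (hpq : (p : ℤ) ≤ 2 ^ (q - 1) - 3) {a b c : ℕ} {M : Mat a b}
    {N : Mat b c} (hM : ∀ i j, M i j = .fin 0) (hN : ∀ i j, ∃ t, N i j = .fin t) (i : Fin a)
    (j : Fin c) : mmul p q M N i j = .fin 0 := by
  refine fsum_zeros hp hpq fun k => ?_
  obtain ⟨t, ht⟩ := hN k j
  rw [hM, ht, fmul_fin hp hpq (by simpa using zero_mem_Fset hp hpq), zero_mul]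

/-- An attention layer with zero weights is the identity on finite matrices. -/
lemma attnApply_of_zero (hp : 2 ≤ p) (hpq : (p : ℤ) ≤ 2 ^ (q - 1) - 3) {h m r d n : ℕ}
    (hn : 0 < n) (B : Block h m r d) (hK : ∀ i a b, B.WK i a b = 0) (hQ : ∀ i a b, B.WQ i a b = 0)
    (hV : ∀ i a b, B.WV i a b = 0) (hO : ∀ i a b, B.WO i a b = 0) {X : Mat d n}
    (hX : MatFin p q X) : attnApply p q B X = X := by
  have hXf : ∀ i j, ∃ t ∈ Fset p q, X i j = .fin t := by
    intro i j
    have := hX i j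
    cases hx : X i j with
    | fin x => rw [hx] at this; exact ⟨x, this, rfl⟩
    | _ => rw [hx] at this; exact this.elim
  have hXf' : ∀ i j, ∃ t, X i j = .fin t := fun i j => (hXf i j).imp fun _ => And.right
  have hfin : ∀ {a b : ℕ} {M : Mat a b}, (∀ i j, M i j = .fin 0) → ∀ i j, ∃ t, M i j = .fin t :=
    fun hM i j => ⟨0, hM i j⟩
  funext a b
  obtain ⟨x, hx, hxX⟩ := hXf a b
  rw [attnApply, madd, fsum_zeros hp hpq, hxX, fadd_fin hp hpq (by simpa using hx), add_zero]
  intro i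
  refine zero_mmul hp hpq (fun _ _ => by rw [toEF, hO]) (hfin (zero_mmul hp hpq
    (zero_mmul hp hpq (fun _ _ => by rw [toEF, hV]) hXf') fun j k =>
      fsoftmax_zeros hp hpq hn (fun l => ?_) j)) a b
  exact zero_mmul hp hpq
    (fun _ _ => zero_mmul hp hpq (fun _ _ => by rw [toEF, hK]) hXf' _ _)
    (hfin (zero_mmul hp hpq (fun _ _ => by rw [toEF, hQ]) hXf')) _ _

end Attention

section Layer

variable {p q : ℕ} {R K : Type}

/-- Every label occurs at exactly one coordinate; unlabelled coordinates are padding. -/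
def IsLabelling {n : ℕ} {α : Type} (σ : Fin n → Option α) : Prop :=
  (∀ a, ∃ i, σ i = some a) ∧ ∀ a i j, σ i = some a → σ j = some a → i = j

/-- Extension of a labelled vector by zero to the padding coordinates. -/
def padZero {n : ℕ} {α : Type} (σ : Fin n → Option α) (v : α → ℝ) (i : Fin n) : ℝ :=
  (σ i).elim 0 v

lemma padZero_mem (hp : 2 ≤ p) (hpq : (p : ℤ) ≤ 2 ^ (q - 1) - 3) {n : ℕ} {α : Type}
    {σ : Fin n → Option α} {v : α → ℝ} (hv : ∀ a, v a ∈ Fset p q) (i : Fin n) :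
    padZero σ v i ∈ Fset p q := by
  unfold padZero
  cases σ i with
  | none => exact zero_mem_Fset hp hpq
  | some a => exact hv a

/-- Floating-point inner product of two labelled vectors. -/
noncomputable def fdot (p q : ℕ) {n : ℕ} {α : Type} (σ : Fin n → Option α) (w v : α → ℝ) : EF :=
  fsum p q fun i => fmul p q (.fin (padZero σ w i)) (.fin (padZero σ v i))

lemma fdot_single (hp : 2 ≤ p) (hpq : (p : ℤ) ≤ 2 ^ (q - 1) - 3) {n : ℕ} {α : Type}
    {σ : Fin n → Option α} (hσ : IsLabelling σ) {w v : α → ℝ} (a : α) {t : ℝ} (ht : t ∈ Fset p q)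
    (ha : w a * v a = t) (h : ∀ b, b ≠ a → w b * v b = 0) : fdot p q σ w v = .fin t := by
  obtain ⟨i, hi⟩ := hσ.1 a
  have h0 := zero_mem_Fset hp hpq
  refine fsum_single hp hpq (i₀ := i) ht ?_ fun j hj => ?_
  · simp only [padZero, hi, Option.elim]
    rw [fmul_fin hp hpq (by rwa [ha]), ha]
  · cases hσj : σ j with
    | none =>
      simp only [padZero, hσj, Option.elim]
      rw [fmul_fin hp hpq (by simpa using h0), zero_mul]
    | some b =>
      have hb : w b * v b = 0 := h b fun hba => hj (hσ.2 a j i (hba ▸ hσj) hi)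
      simp only [padZero, hσj, Option.elim]
      rw [fmul_fin hp hpq (by rwa [hb]), hb]

lemma fdot_zero (hp : 2 ≤ p) (hpq : (p : ℤ) ≤ 2 ^ (q - 1) - 3) {n : ℕ} {α : Type}
    {σ : Fin n → Option α} {w v : α → ℝ} (h : ∀ b, w b * v b = 0) :
    fdot p q σ w v = .fin 0 := by
  have h0 := zero_mem_Fset hp hpq
  refine fsum_zeros hp hpq fun j => ?_
  have hj : padZero σ w j * padZero σ v j = 0 := by
    unfold padZero
    cases σ j with
    | none => simp
    | some b => exact h b
  rw [fmul_fin hp hpq (by rwa [hj]), hj]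

lemma fdot_atMost (hp : 2 ≤ p) (hpq : (p : ℤ) ≤ 2 ^ (q - 1) - 3) {n : ℕ} {α : Type}
    {σ : Fin n → Option α} (hσ : IsLabelling σ) {w v : α → ℝ} (h : ∀ b, w b * v b ≤ 0) (a : α)
    {f : ℝ} (hf : f ∈ Fset p q) (ha : w a * v a ≤ f) : AtMost p q f (fdot p q σ w v) := by
  obtain ⟨i, hi⟩ := hσ.1 a
  refine fsum_atMost hp hpq hf (i₀ := i) (fun j => ?_) ?_
  · refine rnd_atMost hp hpq (zero_mem_Fset hp hpq) ?_
    unfold padZero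
    cases σ j with
    | none => simp
    | some b => exact h b
  · refine rnd_atMost hp hpq hf ?_
    simpa only [padZero, hi, Option.elim] using ha

/-- The block with vanishing attention and output bias whose feed-forward weights are given on
labels. -/
def ffBlock {h m r d : ℕ} (σ : Fin d → Option R) (τ : Fin r → Option K) (w₁ : K → R → ℝ)
    (b₁ : K → ℝ) (w₂ : R → K → ℝ) : Block h m r d where
  WK _ _ _ := 0
  WQ _ _ _ := 0
  WV _ _ _ := 0
  WO _ _ _ := 0
  W1 k i := (τ k).elim 0 fun k' => padZero σ (w₁ k') i
  W2 i k := (σ i).elim 0 fun i' => padZero τ (w₂ i') k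
  b1 := padZero τ b₁
  b2 _ := 0

lemma ffBlock_valid (hp : 2 ≤ p) (hpq : (p : ℤ) ≤ 2 ^ (q - 1) - 3) {h m r d : ℕ}
    {σ : Fin d → Option R} {τ : Fin r → Option K} {w₁ : K → R → ℝ} {b₁ : K → ℝ} {w₂ : R → K → ℝ}
    (hw₁ : ∀ k i, w₁ k i ∈ Fset p q) (hb₁ : ∀ k, b₁ k ∈ Fset p q)
    (hw₂ : ∀ i k, w₂ i k ∈ Fset p q) :
    (ffBlock σ τ w₁ b₁ w₂ : Block h m r d).Valid p q := by
  have h0 := zero_mem_Fset hp hpq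
  refine ⟨fun _ _ _ => h0, fun _ _ _ => h0, fun _ _ _ => h0, fun _ _ _ => h0, fun k i => ?_,
    fun i k => ?_, fun k => padZero_mem hp hpq hb₁ k, fun _ => h0⟩
  · simp only [ffBlock]
    cases τ k with
    | none => exact h0
    | some k' => exact padZero_mem hp hpq (hw₁ k') i
  · simp only [ffBlock]
    cases σ i with
    | none => exact h0
    | some i' => exact padZero_mem hp hpq (hw₂ i') k

/-- The feed-forward layer with weights `w₁`, `b₁`, `w₂` turns the token state `v` into `v'`. -/
def Step (p q : ℕ) {r d : ℕ} (σ : Fin d → Option R) (τ : Fin r → Option K) (w₁ : K → R → ℝ)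
    (b₁ : K → ℝ) (w₂ : R → K → ℝ) (v v' : R → ℝ) : Prop :=
  ∃ g : K → ℝ,
    (∀ k, frelu p q (fadd p q (fdot p q σ (w₁ k) v) (.fin (b₁ k))) = .fin (g k)) ∧
    ∀ i, ∃ o ∈ Fset p q, v i + o = v' i ∧ fdot p q τ (w₂ i) g = .fin o

/-- The matrix whose columns are the given labelled vectors. -/
def stateMat {d n : ℕ} (σ : Fin d → Option R) (v : Fin n → R → ℝ) : Mat d n :=
  fun i j => .fin (padZero σ (v j) i)

lemma ffBlock_apply (hp : 2 ≤ p) (hpq : (p : ℤ) ≤ 2 ^ (q - 1) - 3) {h m r d n : ℕ} (hn : 0 < n)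
    {σ : Fin d → Option R} {τ : Fin r → Option K} {w₁ : K → R → ℝ} {b₁ : K → ℝ} {w₂ : R → K → ℝ}
    {v v' : Fin n → R → ℝ} (hv : ∀ j i, v j i ∈ Fset p q) (hv' : ∀ j i, v' j i ∈ Fset p q)
    (hstep : ∀ j, Step p q σ τ w₁ b₁ w₂ (v j) (v' j)) :
    (ffBlock σ τ w₁ b₁ w₂ : Block h m r d).apply p q (stateMat σ v) = stateMat σ v' := by
  have h0 := zero_mem_Fset hp hpq
  rw [Block.apply, attnApply_of_zero hp hpq hn (X := stateMat σ v) _ (fun _ _ _ => rfl) (fun _ _ _ => rfl)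
    (fun _ _ _ => rfl) (fun _ _ _ => rfl) fun i j => padZero_mem hp hpq (hv j) i]
  funext i j
  obtain ⟨g, hg, ho⟩ := hstep j
  have hhid : ∀ k : Fin r, frelu p q (fadd p q (mmul p q
      (toEF (ffBlock σ τ w₁ b₁ w₂ : Block h m r d).W1) (stateMat σ v) k j)
        (.fin (padZero τ b₁ k))) = .fin (padZero τ g k) := by
    intro k
    simp only [mmul, toEF, ffBlock, stateMat]
    cases hk : τ k with
    | none =>
      simp only [padZero, hk, Option.elim]
      rw [fsum_zeros hp hpq fun i => by rw [fmul_fin hp hpq (by simpa using h0), zero_mul],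
        fadd_fin hp hpq (by simpa using h0), frelu_fin hp hpq (by simpa using h0)]
      simp
    | some k' =>
      have := hg k'
      simpa only [padZero, hk, Option.elim, fdot] using this
  have hout : mmul p q (toEF (ffBlock σ τ w₁ b₁ w₂ : Block h m r d).W2)
      (fun i j => frelu p q (madd p q (mmul p q (toEF (ffBlock σ τ w₁ b₁ w₂ : Block h m r d).W1)
        (stateMat σ v)) (fun a _ => .fin ((ffBlock σ τ w₁ b₁ w₂ : Block h m r d).b1 a)) i j)) i j
      = (σ i).elim (.fin 0) fun i' => fdot p q τ (w₂ i') g := by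
    have : ∀ k : Fin r, frelu p q (madd p q
        (mmul p q (toEF (ffBlock σ τ w₁ b₁ w₂ : Block h m r d).W1)
        (stateMat σ v)) (fun a _ => .fin ((ffBlock σ τ w₁ b₁ w₂ : Block h m r d).b1 a)) k j)
        = .fin (padZero τ g k) := hhid
    rw [mmul]
    simp only [this, toEF]
    cases hi : σ i with
    | none =>
      refine fsum_zeros hp hpq fun k => ?_
      simp only [ffBlock, hi, Option.elim]
      rw [fmul_fin hp hpq (by simpa using h0), zero_mul]
    | some i' => simp only [ffBlock, hi, Option.elim, fdot]
  rw [ffApply, madd, madd, hout]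
  simp only [ffBlock, stateMat]
  cases hi : σ i with
  | none =>
    simp only [padZero, hi, Option.elim]
    rw [fadd_fin hp hpq (by simpa using h0), add_zero, fadd_fin hp hpq (by simpa using h0),
      add_zero]
  | some i' =>
    obtain ⟨o, hoF, hvo, hdot⟩ := ho i'
    simp only [padZero, hi, Option.elim, hdot]
    rw [fadd_fin hp hpq (by simpa using hoF), add_zero,
      fadd_fin hp hpq (by rw [hvo]; exact hv' j i'), hvo]

end Layer

noncomputable section Construction

/-- Finite floats. -/
abbrev Fl (p q : ℕ) := {x : ℝ // x ∈ Fset p q}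

/-- Nonnegative finite floats. -/
abbrev NNFl (p q : ℕ) := {x : ℝ // x ∈ Fset p q ∧ 0 ≤ x}

/-- Labels for the positive and negative parts of the input coordinates. -/
abbrev Half (d₁ : ℕ) := Fin d₁ × Bool

/-- Labels for the signed comparisons of those parts with all nonnegative floats. -/
abbrev Cmp (p q d₁ : ℕ) := Half d₁ × NNFl p q × Bool

/-- Labels for all possible tokens. -/
abbrev Token (p q d₁ : ℕ) := Fin d₁ → Fl p q

/-- Labels of the auxiliary coordinates and of the hidden neurons. -/
abbrev Node (p q d₁ : ℕ) := Half d₁ ⊕ Cmp p q d₁ ⊕ Token p q d₁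

/-- Labels of all coordinates; the first `D` of them carry the input and the output. -/
abbrev Row (p q d₁ D : ℕ) := Fin D ⊕ Node p q d₁

variable {p q d₁ D : ℕ}

/-- The sign encoded by a Boolean. -/
def sgn (s : Bool) : ℝ := if s then 1 else -1

lemma sgn_mul_mem {s : Bool} {x : ℝ} (hx : x ∈ Fset p q) : sgn s * x ∈ Fset p q := by
  cases s
  · simpa [sgn] using neg_mem_Fset hx
  · simpa [sgn] using hx

lemma sgn_mem (hp : 2 ≤ p) (hpq : (p : ℤ) ≤ 2 ^ (q - 1) - 3) (s : Bool) : sgn s ∈ Fset p q := by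
  simpa using sgn_mul_mem (s := s) (one_mem_Fset hp hpq)

lemma max_zero_mem (hp : 2 ≤ p) (hpq : (p : ℤ) ≤ 2 ^ (q - 1) - 3) {x : ℝ} (hx : x ∈ Fset p q) :
    max x 0 ∈ Fset p q := by
  rcases max_choice x 0 with h | h <;> rw [h]
  exacts [hx, zero_mem_Fset hp hpq]

/-- The positive and negative parts of a token. -/
def halves (x : Token p q d₁) (b : Half d₁) : ℝ := max (sgn b.2 * x b.1) 0

lemma halves_mem (hp : 2 ≤ p) (hpq : (p : ℤ) ≤ 2 ^ (q - 1) - 3) (x : Token p q d₁) (b : Half d₁) :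
    halves x b ∈ Fset p q :=
  max_zero_mem hp hpq (sgn_mul_mem (x b.1).2)

lemma halves_nonneg (x : Token p q d₁) (b : Half d₁) : 0 ≤ halves x b := le_max_right _ _

lemma halves_injective : Function.Injective (halves (p := p) (q := q) (d₁ := d₁)) := by
  intro x x' h
  funext i
  have h1 := congrFun h (i, true)
  have h2 := congrFun h (i, false)
  simp only [halves, sgn, if_true, Bool.false_eq_true, if_false, one_mul, neg_one_mul] at h1 h2
  ext
  rcases le_total (x i : ℝ) 0 with a | a <;> rcases le_total (x' i : ℝ) 0 with b | b <;>
    simp only [max_eq_left, max_eq_right, a, b, neg_nonneg, neg_nonpos] at h1 h2 <;> linarith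

/-- The state carrying a vector in its leading coordinates. -/
def ioState {k : ℕ} (x : Fin k → ℝ) : Row p q d₁ D → ℝ
  | .inl a => if h : (a : ℕ) < k then x ⟨a, h⟩ else 0
  | .inr _ => 0

/-- The state carrying a vector in its auxiliary coordinates. -/
def nodeState (g : Node p q d₁ → ℝ) : Row p q d₁ D → ℝ
  | .inl _ => 0
  | .inr k => g k

/-- Output weights that act diagonally on the auxiliary coordinates. -/
def diagOut (wA : Fin D → Node p q d₁ → ℝ) (c : Node p q d₁ → ℝ) :
    Row p q d₁ D → Node p q d₁ → ℝ
  | .inl a => wA a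
  | .inr k => fun k' => if k' = k then c k else 0

lemma diagOut_mem (hp : 2 ≤ p) (hpq : (p : ℤ) ≤ 2 ^ (q - 1) - 3)
    {wA : Fin D → Node p q d₁ → ℝ} {c : Node p q d₁ → ℝ} (hA : ∀ a k, wA a k ∈ Fset p q)
    (hc : ∀ k, c k ∈ Fset p q) (i : Row p q d₁ D) (k : Node p q d₁) :
    diagOut wA c i k ∈ Fset p q := by
  cases i with
  | inl a => exact hA a k
  | inr k' =>
    simp only [diagOut]
    split_ifs
    exacts [hc k', zero_mem_Fset hp hpq]

variable {d r : ℕ} {σ : Fin d → Option (Row p q d₁ D)} {τ : Fin r → Option (Node p q d₁)}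

lemma step_diagOut (hp : 2 ≤ p) (hpq : (p : ℤ) ≤ 2 ^ (q - 1) - 3) (hτ : IsLabelling τ)
    {w₁ : Node p q d₁ → Row p q d₁ D → ℝ} {b₁ : Node p q d₁ → ℝ}
    {wA : Fin D → Node p q d₁ → ℝ} {c : Node p q d₁ → ℝ} {v v' : Row p q d₁ D → ℝ}
    (g : Node p q d₁ → ℝ)
    (hg : ∀ k, frelu p q (fadd p q (fdot p q σ (w₁ k) v) (.fin (b₁ k))) = .fin (g k))
    (hA : ∀ a, ∃ o ∈ Fset p q, v (.inl a) + o = v' (.inl a) ∧ fdot p q τ (wA a) g = .fin o)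
    (hc : ∀ k, c k * g k ∈ Fset p q) (hv : ∀ k, v (.inr k) + c k * g k = v' (.inr k)) :
    Step p q σ τ w₁ b₁ (diagOut wA c) v v' := by
  refine ⟨g, hg, ?_⟩
  rintro (a | k)
  · exact hA a
  · exact ⟨_, hc k, hv k, fdot_single hp hpq hτ k (hc k) (by simp [diagOut])
      fun k' hk' => by simp [diagOut, hk']⟩

lemma frelu_single (hp : 2 ≤ p) (hpq : (p : ℤ) ≤ 2 ^ (q - 1) - 3) (hσ : IsLabelling σ)
    {w v : Row p q d₁ D → ℝ} (a : Row p q d₁ D) (ha : w a * v a ∈ Fset p q)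
    (h : ∀ b, b ≠ a → w b * v b = 0) {b : ℝ} (hb : w a * v a + b ∈ Fset p q) :
    frelu p q (fadd p q (fdot p q σ w v) (.fin b)) = .fin (max (w a * v a + b) 0) := by
  rw [fdot_single hp hpq hσ a ha rfl h, fadd_fin hp hpq hb, frelu_fin hp hpq hb]

lemma frelu_zero (hp : 2 ≤ p) (hpq : (p : ℤ) ≤ 2 ^ (q - 1) - 3)
    {w v : Row p q d₁ D → ℝ} (h : ∀ b, w b * v b = 0) {b : ℝ} (hb : b ∈ Fset p q) :
    frelu p q (fadd p q (fdot p q σ w v) (.fin b)) = .fin (max b 0) := by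
  rw [fdot_zero hp hpq h, fadd_fin hp hpq (by simpa using hb), zero_add, frelu_fin hp hpq hb]

/-! The first layer splits the token into positive and negative parts. -/

/-- Input weights of the splitting layer. -/
def splitIn : Node p q d₁ → Row p q d₁ D → ℝ
  | .inl b, .inl a => if (a : ℕ) = b.1 then sgn b.2 else 0
  | _, _ => 0

/-- Output weights of the splitting layer on the leading coordinates. -/
def splitA : Fin D → Node p q d₁ → ℝ
  | a, .inl b => if (a : ℕ) = b.1 then -sgn b.2 else 0
  | _, _ => 0

/-- Diagonal output weights of the splitting layer. -/
def splitDiag : Node p q d₁ → ℝ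
  | .inl _ => 1
  | _ => 0

lemma step_split (hp : 2 ≤ p) (hpq : (p : ℤ) ≤ 2 ^ (q - 1) - 3) (hD : d₁ ≤ D)
    (hσ : IsLabelling σ) (hτ : IsLabelling τ) (x : Token p q d₁) :
    Step p q σ τ splitIn 0 (diagOut splitA splitDiag) (ioState fun i => (x i : ℝ))
      (nodeState (Sum.elim (halves x) 0)) := by
  have h0 := zero_mem_Fset hp hpq
  refine step_diagOut hp hpq hτ (Sum.elim (halves x) 0) ?_ ?_ ?_ ?_
  · rintro (⟨i, s⟩ | k)
    · have hval : splitIn (p := p) (q := q) (.inl (i, s)) (.inl (Fin.castLE hD i)) *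
          ioState (p := p) (q := q) (d₁ := d₁) (fun i => (x i : ℝ)) (.inl (Fin.castLE hD i))
          = sgn s * x i := by
        simp [splitIn, ioState]
      have hmem := sgn_mul_mem (s := s) (x i).2
      refine (frelu_single hp hpq hσ (.inl (Fin.castLE hD i)) (by rwa [hval]) ?_
        (by simpa [hval] using hmem)).trans ?_
      · rintro (a | k) hne
        · have : (a : ℕ) ≠ i := fun h => hne (congrArg Sum.inl (Fin.ext h))
          simp [splitIn, this]
        · simp [splitIn]
      · rw [hval]
        simp [halves]
    · refine (frelu_zero hp hpq (fun b => ?_) h0).trans (by simp)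
      simp [splitIn]
  · intro a
    by_cases ha : (a : ℕ) < d₁
    · refine ⟨-(x ⟨a, ha⟩ : ℝ), neg_mem_Fset (x ⟨a, ha⟩).2, by simp [ioState, nodeState, ha], ?_⟩
      refine fdot_single hp hpq hτ (.inl (⟨a, ha⟩, decide (0 ≤ (x ⟨a, ha⟩ : ℝ))))
        (neg_mem_Fset (x ⟨a, ha⟩).2) ?_ ?_
      · by_cases hx : 0 ≤ (x ⟨a, ha⟩ : ℝ)
        · simp [splitA, halves, sgn, hx]
        · simp [splitA, halves, sgn, hx, (not_le.1 hx).le]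
      · rintro (⟨i, s⟩ | k) hne
        · by_cases hi : (a : ℕ) = i
          · obtain rfl : i = ⟨a, ha⟩ := Fin.ext hi.symm
            by_cases hx : 0 ≤ (x ⟨a, ha⟩ : ℝ)
            · cases s
              · simp [halves, sgn, hx]
              · simp [hx] at hne
            · cases s
              · simp [hx] at hne
              · simp [halves, sgn, (not_le.1 hx).le]
          · simp [splitA, hi]
        · simp
    · refine ⟨0, h0, by simp [ioState, nodeState, ha], fdot_zero hp hpq ?_⟩
      rintro (⟨i, s⟩ | k)
      · have : (a : ℕ) ≠ i := fun h => ha (h ▸ i.2)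
        simp [splitA, this]
      · simp
  · rintro (b | k)
    · simpa [splitDiag] using halves_mem hp hpq x b
    · simpa [splitDiag] using h0
  · rintro (b | k) <;> simp [splitDiag, ioState, nodeState]

/-! The second layer compares these parts with all nonnegative floats. -/

lemma exists_cmp (hp : 2 ≤ p) (hpq : (p : ℤ) ≤ 2 ^ (q - 1) - 3) {y a : ℝ} (hy : y ∈ Fset p q)
    (hy0 : 0 ≤ y) (ha : a ∈ Fset p q) (ha0 : 0 ≤ a) (s : Bool) :
    ∃ u ∈ Fset p q, 0 ≤ u ∧
      frelu p q (fadd p q (.fin (sgn s * y)) (.fin (-sgn s * a))) = .fin u ∧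
      (y = a → u = 0) ∧ (0 < sgn s * (y - a) → (2 : ℝ) ^ (emin q - (p : ℤ)) ≤ u) := by
  have hyO := (le_abs_self _).trans (abs_le_Omega hy)
  have haO := (le_abs_self _).trans (abs_le_Omega ha)
  have ht := Omega_add_one_lt_thr hpq
  have h0 := zero_mem_Fset hp hpq
  have heq : sgn s * y + -sgn s * a = sgn s * (y - a) := by ring
  have hlt : sgn s * (y - a) < thr p q ∧ -thr p q < sgn s * (y - a) := by
    cases s <;> simp only [sgn, if_true, Bool.false_eq_true, if_false] <;> constructor <;> linarith
  rcases lt_or_ge 0 (sgn s * (y - a)) with hpos | hneg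
  · have htiny : (2 : ℝ) ^ (emin q - (p : ℤ)) ≤ sgn s * (y - a) := by
      cases s
      · simp only [sgn, Bool.false_eq_true, if_false] at hpos ⊢
        have := tiny_le_sub ha hy (by linarith)
        linarith
      · simp only [sgn, if_true] at hpos ⊢
        have := tiny_le_sub hy ha (by linarith)
        linarith
    obtain ⟨u, hu, hru, hle⟩ := exists_rnd_ge hp hpq (tiny_mem_Fset hp hpq) htiny hlt.1
    have hu0 : 0 ≤ u := le_trans (by positivity) hle
    refine ⟨u, hu, hu0, ?_, ?_, fun _ => hle⟩
    · rw [fadd, heq, hru, frelu_fin hp hpq hu, max_eq_left hu0]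
    · rintro rfl
      simp at hpos
  · exact ⟨0, h0, le_rfl, by
      rw [fadd, heq]
      exact frelu_atMost_zero hp hpq (rnd_atMost hp hpq h0 hneg), fun _ => rfl,
      fun h => absurd h (not_lt.2 hneg)⟩

/-- Input weights of the comparison layer. -/
def cmpIn : Node p q d₁ → Row p q d₁ D → ℝ
  | .inl b, .inr (.inl b') => if b' = b then 1 else 0
  | .inr (.inl c), .inr (.inl b') => if b' = c.1 then sgn c.2.2 else 0
  | _, _ => 0

/-- Bias of the comparison layer. -/
def cmpBias : Node p q d₁ → ℝ
  | .inr (.inl c) => -sgn c.2.2 * c.2.1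
  | _ => 0

/-- Diagonal output weights of the comparison layer. -/
def cmpDiag : Node p q d₁ → ℝ
  | .inl _ => -1
  | .inr (.inl _) => 1
  | _ => 0

lemma step_cmp (hp : 2 ≤ p) (hpq : (p : ℤ) ≤ 2 ^ (q - 1) - 3)
    (hσ : IsLabelling σ) (hτ : IsLabelling τ) (x : Token p q d₁) {u : Cmp p q d₁ → ℝ}
    (huF : ∀ c, u c ∈ Fset p q)
    (hu : ∀ c : Cmp p q d₁, frelu p q (fadd p q (.fin (sgn c.2.2 * halves x c.1))
      (.fin (-sgn c.2.2 * c.2.1))) = .fin (u c)) :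
    Step p q σ τ cmpIn cmpBias (diagOut 0 cmpDiag) (nodeState (Sum.elim (halves x) 0))
      (nodeState (Sum.elim 0 (Sum.elim u 0))) := by
  have h0 := zero_mem_Fset hp hpq
  have hyF := halves_mem hp hpq x
  refine step_diagOut hp hpq hτ (Sum.elim (halves x) (Sum.elim u 0)) ?_ ?_ ?_ ?_
  · rintro (b | c | y)
    · refine (frelu_single hp hpq hσ (.inr (.inl b)) (by simpa [cmpIn, nodeState] using hyF b) ?_
        (by simpa [cmpIn, nodeState, cmpBias] using hyF b)).trans ?_
      · rintro (a | b' | k) hne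
        · simp [cmpIn]
        · have : b' ≠ b := fun h => hne (by rw [h])
          simp [cmpIn, this]
        · simp [cmpIn]
      · simp [cmpIn, nodeState, cmpBias, halves_nonneg]
    · rw [fdot_single hp hpq hσ (.inr (.inl c.1)) (sgn_mul_mem (s := c.2.2) (hyF c.1))
        (by simp [cmpIn, nodeState])]
      · exact hu c
      · rintro (a | b' | k) hne
        · simp [cmpIn]
        · have : b' ≠ c.1 := fun h => hne (by rw [h])
          simp [cmpIn, this]
        · simp [cmpIn]
    · refine (frelu_zero hp hpq (fun b => ?_) h0).trans (by simp)
      simp [cmpIn]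
  · exact fun a => ⟨0, h0, by simp [nodeState], fdot_zero hp hpq (by simp)⟩
  · rintro (b | c | y)
    · simpa [cmpDiag] using neg_mem_Fset (hyF b)
    · simpa [cmpDiag] using huF c
    · simpa [cmpDiag] using h0
  · rintro (b | c | y) <;> simp [cmpDiag, nodeState]

/-! The third layer detects the token from the comparisons. -/

/-- Input weights of the detection layer. -/
def selIn : Node p q d₁ → Row p q d₁ D → ℝ
  | .inr (.inl c), .inr (.inr (.inl c')) => if c' = c then 1 else 0
  | .inr (.inr x), .inr (.inr (.inl c)) =>
      if (c.2.1 : ℝ) = halves x c.1 then -(2 : ℝ) ^ emax q else 0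
  | _, _ => 0

/-- Bias of the detection layer. -/
def selBias : Node p q d₁ → ℝ
  | .inr (.inr _) => (2 : ℝ) ^ (-(p : ℤ))
  | _ => 0

/-- Diagonal output weights of the detection layer. -/
def selDiag : Node p q d₁ → ℝ
  | .inr (.inl _) => -1
  | .inr (.inr _) => (2 : ℝ) ^ (p : ℤ)
  | _ => 0

lemma zpow_neg_prec_mem (hp : 2 ≤ p) (hpq : (p : ℤ) ≤ 2 ^ (q - 1) - 3) :
    (2 : ℝ) ^ (-(p : ℤ)) ∈ Fset p q :=
  zpow_mem_Fset (by unfold emin; linarith) (by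
    have := five_le hp hpq
    unfold emax; omega)

/-- Indicator of a token. -/
def indic (x y : Token p q d₁) : ℝ := if y = x then 1 else 0

lemma step_sel (hp : 2 ≤ p) (hpq : (p : ℤ) ≤ 2 ^ (q - 1) - 3)
    (hσ : IsLabelling σ) (hτ : IsLabelling τ) (x : Token p q d₁) {u : Cmp p q d₁ → ℝ}
    (huF : ∀ c, u c ∈ Fset p q) (hu0 : ∀ c, 0 ≤ u c)
    (hueq : ∀ c : Cmp p q d₁, halves x c.1 = c.2.1 → u c = 0)
    (hupos : ∀ c : Cmp p q d₁, 0 < sgn c.2.2 * (halves x c.1 - c.2.1) →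
      (2 : ℝ) ^ (emin q - (p : ℤ)) ≤ u c) :
    Step p q σ τ selIn selBias (diagOut 0 selDiag) (nodeState (Sum.elim 0 (Sum.elim u 0)))
      (nodeState (Sum.elim 0 (Sum.elim 0 (indic x)))) := by
  have h0 := zero_mem_Fset hp hpq
  have hprec := zpow_neg_prec_mem hp hpq
  have hpow : (2 : ℝ) ^ (p : ℤ) * (2 : ℝ) ^ (-(p : ℤ)) = 1 := by
    rw [← zpow_add₀ (by norm_num)]; simp
  refine step_diagOut hp hpq hτ
    (Sum.elim 0 (Sum.elim u fun y => (2 : ℝ) ^ (-(p : ℤ)) * indic x y)) ?_ ?_ ?_ ?_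
  · rintro (b | c | y)
    · refine (frelu_zero hp hpq (fun b => ?_) h0).trans (by simp)
      simp [selIn]
    · refine (frelu_single hp hpq hσ (.inr (.inr (.inl c)))
        (by simpa [selIn, nodeState] using huF c) ?_
        (by simpa [selIn, nodeState, selBias] using huF c)).trans ?_
      · rintro (a | b' | c' | k) hne
        · simp [selIn]
        · simp [selIn]
        · have : c' ≠ c := fun h => hne (by rw [h])
          simp [selIn, this]
        · simp [selIn]
      · simp [selIn, nodeState, selBias, hu0]
    · by_cases hyx : y = x
      · subst hyx
        refine (frelu_zero hp hpq ?_ hprec).trans ?_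
        · rintro (a | b' | c' | k)
          · simp [selIn]
          · simp [selIn]
          · by_cases hc : (c'.2.1 : ℝ) = halves y c'.1
            · simp [nodeState, hueq c' hc.symm]
            · simp [selIn, hc]
          · simp [selIn]
        · have : (0 : ℝ) ≤ (2 : ℝ) ^ (-(p : ℤ)) := by positivity
          simp [indic]
      · obtain ⟨b, hb⟩ : ∃ b, halves x b ≠ halves y b := by
          by_contra! hcon
          exact hyx (halves_injective (funext hcon)).symm
        have hf : -(2 : ℝ) ^ (1 - (p : ℤ)) ∈ Fset p q := by
          refine neg_mem_Fset (zpow_mem_Fset (by unfold emin; linarith) ?_)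
          have := five_le hp hpq
          unfold emax; omega
        let c : Cmp p q d₁ := (b, ⟨halves y b, halves_mem hp hpq y b, halves_nonneg y b⟩,
          decide (halves y b < halves x b))
        have hc : (2 : ℝ) ^ (emin q - (p : ℤ)) ≤ u c := by
          refine hupos c ?_
          rcases lt_or_gt_of_ne hb with h | h
          · simp [c, sgn, not_lt.2 h.le, h]
          · simp [c, sgn, h]
        have hdot : AtMost p q (-(2 : ℝ) ^ (1 - (p : ℤ)))
            (fdot p q σ (selIn (.inr (.inr y))) (nodeState (Sum.elim 0 (Sum.elim u 0)))) := by
          refine fdot_atMost hp hpq hσ ?_ (.inr (.inr (.inl c))) hf ?_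
          · rintro (a | b' | c' | k)
            · simp [selIn]
            · simp [selIn]
            · simp only [selIn, nodeState, Sum.elim_inr, Sum.elim_inl]
              have := hu0 c'
              split_ifs
              · have : (0 : ℝ) ≤ (2 : ℝ) ^ emax q * u c' := by positivity
                linarith
              · simp
            · simp [selIn]
          · have hexp : (2 : ℝ) ^ (1 - (p : ℤ)) = 2 ^ emax q * 2 ^ (emin q - (p : ℤ)) := by
              rw [← zpow_add₀ (by norm_num)]
              congr 1
              unfold emax emin; ring
            have hsel : selIn (D := D) (.inr (.inr y)) (.inr (.inr (.inl c))) =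
                -(2 : ℝ) ^ emax q := by simp [selIn, c]
            rw [hsel, hexp, neg_mul]
            exact neg_le_neg (mul_le_mul_of_nonneg_left hc (by positivity))
        have hind : indic x y = 0 := by simp [indic, hyx]
        simp only [Sum.elim_inr, hind, mul_zero]
        refine frelu_atMost_zero hp hpq (hdot.fadd hp hpq h0 (y := (2 : ℝ) ^ (-(p : ℤ))) ?_
          (Or.inr ⟨_, hprec, le_rfl, rfl⟩))
        have : (2 : ℝ) ^ (-(p : ℤ)) ≤ (2 : ℝ) ^ (1 - (p : ℤ)) :=
          zpow_le_zpow_right₀ (by norm_num) (by linarith)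
        linarith
  · exact fun a => ⟨0, h0, by simp [nodeState], fdot_zero hp hpq (by simp)⟩
  · rintro (b | c | y)
    · simpa [selDiag] using h0
    · simpa [selDiag] using neg_mem_Fset (huF c)
    · simp only [selDiag, Sum.elim_inr, ← mul_assoc, hpow, one_mul, indic]
      split_ifs
      exacts [one_mem_Fset hp hpq, h0]
  · rintro (b | c | y)
    · simp [selDiag, nodeState]
    · simp [selDiag, nodeState]
    · simp only [selDiag, nodeState, Sum.elim_inr, ← mul_assoc, hpow, one_mul, Pi.zero_apply,
        zero_add]

/-! The fourth layer writes the value of the function at the detected token. -/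

/-- Input weights of the output layer. -/
def writeIn : Node p q d₁ → Row p q d₁ D → ℝ
  | .inr (.inr y), .inr (.inr (.inr y')) => if y' = y then 1 else 0
  | _, _ => 0

/-- Output weights of the output layer on the leading coordinates. -/
def writeA {d₂ : ℕ} (z : Token p q d₁ → Fin d₂ → ℝ) : Fin D → Node p q d₁ → ℝ
  | a, .inr (.inr y) => if h : (a : ℕ) < d₂ then z y ⟨a, h⟩ else 0
  | _, _ => 0

/-- Diagonal output weights of the output layer. -/
def writeDiag : Node p q d₁ → ℝ
  | .inr (.inr _) => -1
  | _ => 0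

lemma indic_mem (hp : 2 ≤ p) (hpq : (p : ℤ) ≤ 2 ^ (q - 1) - 3) (x y : Token p q d₁) :
    indic x y ∈ Fset p q := by
  unfold indic
  split_ifs
  exacts [one_mem_Fset hp hpq, zero_mem_Fset hp hpq]

lemma writeA_mem (hp : 2 ≤ p) (hpq : (p : ℤ) ≤ 2 ^ (q - 1) - 3) {d₂ : ℕ}
    {z : Token p q d₁ → Fin d₂ → ℝ} (hz : ∀ y i, z y i ∈ Fset p q) (a : Fin D)
    (k : Node p q d₁) : writeA z a k ∈ Fset p q := by
  rcases k with b | c | y <;> simp only [writeA]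
  · exact zero_mem_Fset hp hpq
  · exact zero_mem_Fset hp hpq
  · split_ifs
    exacts [hz _ _, zero_mem_Fset hp hpq]

lemma step_write (hp : 2 ≤ p) (hpq : (p : ℤ) ≤ 2 ^ (q - 1) - 3)
    (hσ : IsLabelling σ) (hτ : IsLabelling τ) (x : Token p q d₁) {d₂ : ℕ}
    {z : Token p q d₁ → Fin d₂ → ℝ} (hz : ∀ y i, z y i ∈ Fset p q) :
    Step p q σ τ writeIn 0 (diagOut (writeA z) writeDiag)
      (nodeState (Sum.elim 0 (Sum.elim 0 (indic x)))) (ioState (z x)) := by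
  have h0 := zero_mem_Fset hp hpq
  refine step_diagOut hp hpq hτ (Sum.elim 0 (Sum.elim 0 (indic x))) ?_ ?_ ?_ ?_
  · rintro (b | c | y)
    · refine (frelu_zero hp hpq (fun b => ?_) h0).trans (by simp)
      simp [writeIn]
    · refine (frelu_zero hp hpq (fun b => ?_) h0).trans (by simp)
      simp [writeIn]
    · refine (frelu_single hp hpq hσ (.inr (.inr (.inr y)))
        (by simpa [writeIn, nodeState] using indic_mem hp hpq x y) ?_
        (by simpa [writeIn, nodeState] using indic_mem hp hpq x y)).trans ?_
      · rintro (a | b' | c' | y') hne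
        · simp [writeIn]
        · simp [writeIn]
        · simp [writeIn]
        · have : y' ≠ y := fun h => hne (by rw [h])
          simp [writeIn, this]
      · have : 0 ≤ indic x y := by
          unfold indic
          split_ifs <;> norm_num
        simp [writeIn, nodeState, this]
  · intro a
    have hval : writeA z a (.inr (.inr x)) = ioState (p := p) (q := q) (d₁ := d₁) (z x) (.inl a) :=
      rfl
    refine ⟨_, writeA_mem hp hpq hz a (.inr (.inr x)), by rw [hval]; simp [nodeState],
      fdot_single hp hpq hτ (.inr (.inr x)) (writeA_mem hp hpq hz a _) (by simp [indic]) ?_⟩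
    rintro (b | c | y) hne
    · simp
    · simp
    · have : y ≠ x := fun h => hne (by rw [h])
      simp [indic, this]
  · rintro (b | c | y)
    · simpa [writeDiag] using h0
    · simpa [writeDiag] using h0
    · simpa [writeDiag] using neg_mem_Fset (indic_mem hp hpq x y)
  · rintro (b | c | y) <;> simp [writeDiag, nodeState, ioState]

lemma exists_labelling {α : Type} [Finite α] {r : ℕ} (hr : Nat.card α ≤ r) :
    ∃ τ : Fin r → Option α, IsLabelling τ := by
  let e := Finite.equivFin α
  refine ⟨fun i => if h : (i : ℕ) < Nat.card α then some (e.symm ⟨i, h⟩) else none, ?_, ?_⟩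
  · intro a
    exact ⟨Fin.castLE hr (e a), by simp⟩
  · intro a i j hi hj
    have key : ∀ i : Fin r, (if h : (i : ℕ) < Nat.card α then some (e.symm ⟨i, h⟩) else none)
        = some a → (i : ℕ) = e a := by
      intro i hi
      split_ifs at hi
      rw [← Option.some.inj hi, Equiv.apply_symm_apply]
    exact Fin.ext ((key i hi).trans (key j hj).symm)

lemma exists_row_labelling {β : Type} [Finite β] (hd : D + Nat.card β ≤ d) :
    ∃ σ : Fin d → Option (Fin D ⊕ β), IsLabelling σ ∧
      (∀ (i : Fin d) (h : (i : ℕ) < D), σ i = some (.inl ⟨i, h⟩)) ∧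
      ∀ i : Fin d, D ≤ (i : ℕ) → ∀ a, σ i ≠ some (.inl a) := by
  obtain ⟨τ, hτ⟩ := exists_labelling (α := β) (r := d - D) (by omega)
  refine ⟨fun i => if h : (i : ℕ) < D then some (.inl ⟨i, h⟩) else
    (τ ⟨i - D, by omega⟩).map .inr, ⟨?_, ?_⟩, fun i h => dif_pos h, fun i h a => ?_⟩
  · rintro (a | b)
    · exact ⟨⟨a, by omega⟩, by simp⟩
    · obtain ⟨i, hi⟩ := hτ.1 b
      exact ⟨⟨D + i, by omega⟩, by simp [hi]⟩
  · rintro (a | b) i j hi hj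
    · have key : ∀ i : Fin d, (if h : (i : ℕ) < D then some (.inl ⟨i, h⟩) else
          (τ ⟨i - D, by omega⟩).map .inr : Option (Fin D ⊕ β)) = some (.inl a) →
          (i : ℕ) = a := by
        intro i hi
        split_ifs at hi
        · simpa using congrArg Fin.val (Sum.inl.inj (Option.some.inj hi))
        · simp at hi
      exact Fin.ext ((key i hi).trans (key j hj).symm)
    · have key : ∀ i : Fin d, (if h : (i : ℕ) < D then some (.inl ⟨i, h⟩) else
          (τ ⟨i - D, by omega⟩).map .inr : Option (Fin D ⊕ β)) = some (.inr b) →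
          D ≤ (i : ℕ) ∧ ∃ h : (i : ℕ) - D < d - D, τ ⟨i - D, h⟩ = some b := by
        intro i hi
        split_ifs at hi with h
        · simp at hi
        · exact ⟨by omega, by omega, by simpa using hi⟩
      obtain ⟨hiD, hi', hi⟩ := key i hi
      obtain ⟨hjD, hj', hj⟩ := key j hj
      have := congrArg Fin.val (hτ.2 b _ _ hi hj)
      simp only at this
      exact Fin.ext (by omega)
  · simp [not_lt.2 h]

lemma splitIn_mem (hp : 2 ≤ p) (hpq : (p : ℤ) ≤ 2 ^ (q - 1) - 3) (k : Node p q d₁)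
    (i : Row p q d₁ D) : splitIn k i ∈ Fset p q := by
  have h0 := zero_mem_Fset hp hpq
  rcases k with b | c | y <;> rcases i with a | b' | c' | y' <;> simp only [splitIn] <;>
    first | exact h0 | skip
  split_ifs
  exacts [sgn_mem hp hpq _, h0]

lemma splitA_mem (hp : 2 ≤ p) (hpq : (p : ℤ) ≤ 2 ^ (q - 1) - 3) (a : Fin D)
    (k : Node p q d₁) : splitA a k ∈ Fset p q := by
  have h0 := zero_mem_Fset hp hpq
  rcases k with b | c | y <;> simp only [splitA] <;> first | exact h0 | skip
  split_ifs
  exacts [neg_mem_Fset (sgn_mem hp hpq _), h0]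

lemma cmpIn_mem (hp : 2 ≤ p) (hpq : (p : ℤ) ≤ 2 ^ (q - 1) - 3) (k : Node p q d₁)
    (i : Row p q d₁ D) : cmpIn k i ∈ Fset p q := by
  have h0 := zero_mem_Fset hp hpq
  rcases k with b | c | y <;> rcases i with a | b' | c' | y' <;> simp only [cmpIn] <;>
    first | exact h0 | split_ifs
  exacts [one_mem_Fset hp hpq, h0, sgn_mem hp hpq _, h0]

lemma cmpBias_mem (hp : 2 ≤ p) (hpq : (p : ℤ) ≤ 2 ^ (q - 1) - 3) (k : Node p q d₁) :
    cmpBias k ∈ Fset p q := by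
  have h0 := zero_mem_Fset hp hpq
  rcases k with b | c | y <;> simp only [cmpBias] <;> first | exact h0 | skip
  rw [neg_mul]
  exact neg_mem_Fset (sgn_mul_mem c.2.1.2.1)

lemma selIn_mem (hp : 2 ≤ p) (hpq : (p : ℤ) ≤ 2 ^ (q - 1) - 3) (k : Node p q d₁)
    (i : Row p q d₁ D) : selIn k i ∈ Fset p q := by
  have h0 := zero_mem_Fset hp hpq
  rcases k with b | c | y <;> rcases i with a | b' | c' | y' <;> simp only [selIn] <;>
    first | exact h0 | split_ifs
  exacts [one_mem_Fset hp hpq, h0, neg_mem_Fset (zpow_mem_Fset (emin_le_emax hp hpq) le_rfl), h0]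

lemma selBias_mem (hp : 2 ≤ p) (hpq : (p : ℤ) ≤ 2 ^ (q - 1) - 3) (k : Node p q d₁) :
    selBias k ∈ Fset p q := by
  rcases k with b | c | y <;> simp only [selBias]
  exacts [zero_mem_Fset hp hpq, zero_mem_Fset hp hpq, zpow_neg_prec_mem hp hpq]

lemma writeIn_mem (hp : 2 ≤ p) (hpq : (p : ℤ) ≤ 2 ^ (q - 1) - 3) (k : Node p q d₁)
    (i : Row p q d₁ D) : writeIn k i ∈ Fset p q := by
  have h0 := zero_mem_Fset hp hpq
  rcases k with b | c | y <;> rcases i with a | b' | c' | y' <;> simp only [writeIn] <;>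
    first | exact h0 | split_ifs
  exacts [one_mem_Fset hp hpq, h0]

lemma splitDiag_mem (hp : 2 ≤ p) (hpq : (p : ℤ) ≤ 2 ^ (q - 1) - 3) (k : Node p q d₁) :
    splitDiag k ∈ Fset p q := by
  rcases k with b | c | y <;> simp only [splitDiag]
  exacts [one_mem_Fset hp hpq, zero_mem_Fset hp hpq, zero_mem_Fset hp hpq]

lemma cmpDiag_mem (hp : 2 ≤ p) (hpq : (p : ℤ) ≤ 2 ^ (q - 1) - 3) (k : Node p q d₁) :
    cmpDiag k ∈ Fset p q := by
  rcases k with b | c | y <;> simp only [cmpDiag]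
  exacts [neg_mem_Fset (one_mem_Fset hp hpq), one_mem_Fset hp hpq, zero_mem_Fset hp hpq]

lemma selDiag_mem (hp : 2 ≤ p) (hpq : (p : ℤ) ≤ 2 ^ (q - 1) - 3) (k : Node p q d₁) :
    selDiag k ∈ Fset p q := by
  rcases k with b | c | y <;> simp only [selDiag]
  · exact zero_mem_Fset hp hpq
  · exact neg_mem_Fset (one_mem_Fset hp hpq)
  · have := five_le hp hpq
    exact zpow_mem_Fset (by unfold emin; omega) (by unfold emax; linarith)

lemma writeDiag_mem (hp : 2 ≤ p) (hpq : (p : ℤ) ≤ 2 ^ (q - 1) - 3) (k : Node p q d₁) :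
    writeDiag k ∈ Fset p q := by
  rcases k with b | c | y <;> simp only [writeDiag]
  exacts [zero_mem_Fset hp hpq, zero_mem_Fset hp hpq, neg_mem_Fset (one_mem_Fset hp hpq)]

lemma ioState_mem (hp : 2 ≤ p) (hpq : (p : ℤ) ≤ 2 ^ (q - 1) - 3) {k : ℕ} {x : Fin k → ℝ}
    (hx : ∀ i, x i ∈ Fset p q) (i : Row p q d₁ D) : ioState x i ∈ Fset p q := by
  rcases i with a | k <;> simp only [ioState]
  · split_ifs
    exacts [hx _, zero_mem_Fset hp hpq]
  · exact zero_mem_Fset hp hpq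

lemma nodeState_mem (hp : 2 ≤ p) (hpq : (p : ℤ) ≤ 2 ^ (q - 1) - 3)
    {f : Half d₁ → ℝ} {u : Cmp p q d₁ → ℝ} {e : Token p q d₁ → ℝ} (hf : ∀ b, f b ∈ Fset p q)
    (hu : ∀ c, u c ∈ Fset p q) (he : ∀ y, e y ∈ Fset p q) (i : Row p q d₁ D) :
    nodeState (Sum.elim f (Sum.elim u e)) i ∈ Fset p q := by
  rcases i with a | b | c | y
  exacts [zero_mem_Fset hp hpq, hf b, hu c, he y]

/-- The four layers that evaluate `z` on tokens. -/
def evalBlocks {h m d₂ : ℕ} (σ : Fin d → Option (Row p q d₁ D)) (τ : Fin r → Option (Node p q d₁))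
    (z : Token p q d₁ → Fin d₂ → ℝ) : List (Block h m r d) :=
  [ffBlock σ τ splitIn 0 (diagOut splitA splitDiag),
    ffBlock σ τ cmpIn cmpBias (diagOut 0 cmpDiag),
    ffBlock σ τ selIn selBias (diagOut 0 selDiag),
    ffBlock σ τ writeIn 0 (diagOut (writeA z) writeDiag)]

lemma evalBlocks_valid (hp : 2 ≤ p) (hpq : (p : ℤ) ≤ 2 ^ (q - 1) - 3) {h m d₂ : ℕ}
    {z : Token p q d₁ → Fin d₂ → ℝ} (hz : ∀ y i, z y i ∈ Fset p q) :
    ∀ B ∈ (evalBlocks σ τ z : List (Block h m r d)), B.Valid p q := by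
  have h0 := zero_mem_Fset hp hpq
  intro B hB
  simp only [evalBlocks, List.mem_cons, List.not_mem_nil, or_false] at hB
  rcases hB with rfl | rfl | rfl | rfl
  · exact ffBlock_valid hp hpq (splitIn_mem hp hpq) (fun _ => h0)
      (diagOut_mem hp hpq (splitA_mem hp hpq) (splitDiag_mem hp hpq))
  · exact ffBlock_valid hp hpq (cmpIn_mem hp hpq) (cmpBias_mem hp hpq)
      (diagOut_mem hp hpq (fun _ _ => h0) (cmpDiag_mem hp hpq))
  · exact ffBlock_valid hp hpq (selIn_mem hp hpq) (selBias_mem hp hpq)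
      (diagOut_mem hp hpq (fun _ _ => h0) (selDiag_mem hp hpq))
  · exact ffBlock_valid hp hpq (writeIn_mem hp hpq) (fun _ => h0)
      (diagOut_mem hp hpq (writeA_mem hp hpq hz) (writeDiag_mem hp hpq))

lemma blocksApply_evalBlocks (hp : 2 ≤ p) (hpq : (p : ℤ) ≤ 2 ^ (q - 1) - 3) (hD : d₁ ≤ D)
    (hσ : IsLabelling σ) (hτ : IsLabelling τ) {h m n d₂ : ℕ} (hn : 0 < n)
    {z : Token p q d₁ → Fin d₂ → ℝ} (hz : ∀ y i, z y i ∈ Fset p q) (x : Fin n → Token p q d₁) :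
    blocksApply p q (evalBlocks σ τ z : List (Block h m r d))
      (stateMat σ fun j => ioState fun i => (x j i : ℝ)) =
      stateMat σ fun j => ioState (z (x j)) := by
  have h0 := zero_mem_Fset hp hpq
  choose u huF hu0 hu hueq hupos using fun (j : Fin n) (c : Cmp p q d₁) =>
    exists_cmp hp hpq (halves_mem hp hpq (x j) c.1) (halves_nonneg (x j) c.1) c.2.1.2.1
      c.2.1.2.2 c.2.2
  have hv0 : ∀ j (i : Row p q d₁ D), ioState (fun i => (x j i : ℝ)) i ∈ Fset p q :=
    fun j => ioState_mem hp hpq fun i => (x j i).2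
  have hv1 : ∀ j (i : Row p q d₁ D), nodeState (Sum.elim (halves (x j)) 0) i ∈ Fset p q := by
    rintro j (a | b | k)
    exacts [h0, halves_mem hp hpq (x j) b, h0]
  have hv2 : ∀ j (i : Row p q d₁ D), nodeState (Sum.elim 0 (Sum.elim (u j) 0)) i ∈ Fset p q :=
    fun j => nodeState_mem hp hpq (fun _ => h0) (huF j) (fun _ => h0)
  have hv3 : ∀ j (i : Row p q d₁ D),
      nodeState (Sum.elim 0 (Sum.elim 0 (indic (x j)))) i ∈ Fset p q :=
    fun j => nodeState_mem hp hpq (fun _ => h0) (fun _ => h0) (indic_mem hp hpq (x j))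
  have hv4 : ∀ j (i : Row p q d₁ D), ioState (z (x j)) i ∈ Fset p q :=
    fun j => ioState_mem hp hpq (hz (x j))
  simp only [blocksApply, evalBlocks, List.foldl_cons, List.foldl_nil]
  rw [ffBlock_apply hp hpq hn hv0 hv1 fun j => step_split hp hpq hD hσ hτ (x j),
    ffBlock_apply hp hpq hn hv1 hv2 fun j => step_cmp hp hpq hσ hτ (x j) (huF j) (hu j),
    ffBlock_apply hp hpq hn hv2 hv3 fun j =>
      step_sel hp hpq hσ hτ (x j) (huF j) (hu0 j) (hueq j) (hupos j),
    ffBlock_apply hp hpq hn hv3 hv4 fun j => step_write hp hpq hσ hτ (x j) hz]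

lemma padZero_ioState (hσ : ∀ (i : Fin d) (h : (i : ℕ) < D), σ i = some (.inl ⟨i, h⟩))
    (hσ' : ∀ i : Fin d, D ≤ (i : ℕ) → ∀ a, σ i ≠ some (.inl a)) {k : ℕ} (hk : k ≤ D)
    (x : Fin k → ℝ) (i : Fin d) :
    padZero σ (ioState x) i = if h : (i : ℕ) < k then x ⟨i, h⟩ else 0 := by
  rcases lt_or_ge (i : ℕ) D with hi | hi
  · simp [padZero, hσ i hi, ioState]
  · rw [dif_neg (by omega), padZero]
    rcases hσi : σ i with _ | (a | b)
    · rfl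
    · exact absurd hσi (hσ' i hi a)
    · rfl

lemma EF.IsF.exists_fin {e : EF} (he : e.IsF p q) : ∃ x : Fl p q, e = .fin x := by
  cases e with
  | fin x => exact ⟨⟨x, he⟩, rfl⟩
  | _ => exact he.elim

end Construction

end FPT


/-- Lemma `token-univ-approx`. For all sufficiently large hidden
dimension `d` and feed-forward width `r`, every token-wise function
`ψ* : 𝔽^{d₁} → 𝔽^{d₂}` is computed by a composition of transformer blocks on inputs whose
first `d₁` rows carry the tokens and whose remaining rows vanish. -/
theorem stmt19 (p q : ℕ) (hp : 2 ≤ p) (hpq : (p : ℤ) ≤ 2 ^ (q - 1) - 3)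
    (d1 d2 m h n : ℕ) (hd1 : 0 < d1) (hd2 : 0 < d2) (hm : 0 < m) (hh : 0 < h)
    (hn : 0 < n) :
    ∃ td tr : ℕ,
      ∀ d r : ℕ, ∀ (_hdd : td ≤ d) (_hrr : tr ≤ r) (hd1d : d1 ≤ d) (hd2d : d2 ≤ d),
        ∀ ψs : (Fin d1 → FPT.EF) → Fin d2 → FPT.EF,
          (∀ x : Fin d1 → FPT.EF, FPT.VecFin p q x → FPT.VecFin p q (ψs x)) →
          ∃ L : List (FPT.Block h m r d), L ≠ [] ∧ (∀ B ∈ L, B.Valid p q) ∧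
            ∀ Z : FPT.Mat d n, FPT.MatFin p q Z →
              (∀ i : Fin d, d1 ≤ (i : ℕ) → ∀ j : Fin n, Z i j = .fin 0) →
              (∀ (i : Fin d2) (j : Fin n),
                FPT.blocksApply p q L Z (Fin.castLE hd2d i) j =
                  ψs (fun a : Fin d1 => Z (Fin.castLE hd1d a) j) i) ∧
              (∀ i : Fin d, d2 ≤ (i : ℕ) → ∀ j : Fin n,
                FPT.blocksApply p q L Z i j = .fin 0) := by
  have hfin : Finite (FPT.Fl p q) := (FPT.Fset_finite p q).to_subtype
  have hfin' : Finite (FPT.NNFl p q) := ((FPT.Fset_finite p q).subset fun _ hx => hx.1).to_subtype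
  refine ⟨max d1 d2 + Nat.card (FPT.Node p q d1), Nat.card (FPT.Node p q d1), ?_⟩
  intro d r hdd hrr hd1d hd2d ψs hψ
  obtain ⟨σ, hσ, hσ1, hσ2⟩ := FPT.exists_row_labelling hdd
  obtain ⟨τ, hτ⟩ := FPT.exists_labelling hrr
  choose z hz using fun (x : FPT.Token p q d1) (i : Fin d2) =>
    (hψ (fun a => .fin (x a)) (fun a => (x a).2) i).exists_fin
  have hzF : ∀ x i, (z x i : ℝ) ∈ FPT.Fset p q := fun x i => (z x i).2
  refine ⟨FPT.evalBlocks σ τ fun x i => (z x i : ℝ), by simp [FPT.evalBlocks],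
    FPT.evalBlocks_valid hp hpq hzF, fun Z hZ hZ0 => ?_⟩
  choose x hx using fun (j : Fin n) (a : Fin d1) => (hZ (Fin.castLE hd1d a) j).exists_fin
  have hZx : Z = FPT.stateMat σ fun j => FPT.ioState fun i => (x j i : ℝ) := by
    funext i j
    rw [FPT.stateMat, FPT.padZero_ioState hσ1 hσ2 (le_max_left _ _)]
    split_ifs with h
    · exact hx j ⟨i, h⟩
    · exact hZ0 i (not_lt.1 h) j
  have hmain : ∀ i j, FPT.blocksApply p q (FPT.evalBlocks σ τ fun x i => (z x i : ℝ) :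
      List (FPT.Block h m r d)) Z i j =
        .fin (if h : (i : ℕ) < d2 then z (x j) ⟨i, h⟩ else 0) := by
    intro i j
    rw [hZx, FPT.blocksApply_evalBlocks hp hpq (le_max_left _ _) hσ hτ hn hzF x, FPT.stateMat,
      FPT.padZero_ioState hσ1 hσ2 (le_max_right _ _)]
  refine ⟨fun i j => ?_, fun i hi j => ?_⟩
  · rw [hmain, dif_pos (by simp)]
    simp only [hx]
    exact (hz (x j) i).symm
  · rw [hmain, dif_neg (not_lt.2 hi)]
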